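/- Let n ≥ 2, α, β > 0, κ ∈ ℝ, let Ω ⊆ ℝⁿ be a nonempty open convex set, and let ρ : Ω → ℝ be smooth with Hess ρ(x)(v,v) ≥ κ‖v‖² for all x ∈ Ω, v ∈ ℝⁿ. Let μ be the measure on Ω with density e^{−ρ} with respect to Lebesgue measure. Let f₁, f₂, f₃, f₄ : Ω → [0,∞) be measurable functions such that for some x₀ ∈ Ω, ∫_Ω (f₁+f₂+f₃+f₄)(x)·(1 + ‖x−x₀‖) dμ(x) < ∞. Assume f₁^α f₂^β ≤ f₃^α f₄^β holds μ-almost everywhere in Ω, and assume that for every probability measure η on Ω which is a CD(κ,∞)-needle and for which f₁, f₂, f₃, f₄ are all η-integrable, (∫f₁ dη)^α (∫f₂ dη)^β ≤ (∫f₃ dη)^α (∫f₄ dη)^β. Then (∫_Ω f₁ dμ)^α (∫_Ω f₂ dμ)^β ≤ (∫_Ω f₃ dμ)^α (∫_Ω f₄ dμ)^β. (Four functions theorem, Euclidean case with N = ∞.) -/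

import Mathlib

open MeasureTheory
open scoped ENNReal

/-- A measure `η` on `Ω ⊆ ℝⁿ` is a `CD(κ,∞)`-needle: the pushforward, under a unit-speed
parametrization `γ` of a segment, of a measure `e^{-Ψ}dt` on a nonempty open interval
`A ⊆ ℝ`, where `Ψ` is smooth with `Ψ'' ≥ κ` on `A`. -/
def IsCDNeedle {n : ℕ} (κ : ℝ) (Ω : Set (EuclideanSpace ℝ (Fin n)))
    (η : Measure (EuclideanSpace ℝ (Fin n))) : Prop :=
  ∃ (A : Set ℝ) (Ψ : ℝ → ℝ) (γ : ℝ → EuclideanSpace ℝ (Fin n)),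
    A.Nonempty ∧ IsOpen A ∧ A.OrdConnected ∧
    ContDiffOn ℝ (⊤ : ℕ∞) Ψ A ∧ (∀ t ∈ A, κ ≤ deriv (deriv Ψ) t) ∧
    Measurable γ ∧ (∀ t ∈ A, γ t ∈ Ω) ∧
    (∀ s ∈ A, ∀ t ∈ A, ‖γ s - γ t‖ = |s - t|) ∧
    η = Measure.map γ
      ((volume.restrict A).withDensity fun t => ENNReal.ofReal (Real.exp (-Ψ t)))

section
open Filter Topology

structure NiceLC (g : ℝ → ℝ) : Prop where
  meas : Measurable g
  nonneg : ∀ x, 0 ≤ g x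
  bdd : ∃ M, ∀ x, g x ≤ M
  supp : ∃ R, ∀ x, R < |x| → g x = 0
  lc : ∀ x y l : ℝ, 0 < l → l < 1 → g x ^ (1 - l) * g y ^ l ≤ g ((1 - l) * x + l * y)

theorem NiceLC.of_concave {g : ℝ → ℝ} {S : Set ℝ} (hS : Bornology.IsBounded S)
    (hm : Measurable g) (h0 : ∀ x, 0 ≤ g x) (hb : ∃ M, ∀ x, g x ≤ M)
    (hz : ∀ x, x ∉ S → g x = 0) (hc : ConcaveOn ℝ S g) : NiceLC g := by
  refine ⟨hm, h0, hb, ?_, ?_⟩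
  · obtain ⟨R, hR⟩ := hS.subset_closedBall 0
    refine ⟨R, fun x hx => hz x fun hxS => ?_⟩
    have := hR hxS
    simp [Metric.mem_closedBall] at this
    linarith
  · intro x y l hl hl1
    by_cases hx : x ∈ S
    · by_cases hy : y ∈ S
      · refine (Real.geom_mean_le_arith_mean2_weighted (by linarith) hl.le (h0 x) (h0 y)
          (by ring)).trans ?_
        exact hc.2 hx hy (by linarith) hl.le (by ring)
      · rw [hz y hy, Real.zero_rpow hl.ne', mul_zero]; exact h0 _
    · rw [hz x hx, Real.zero_rpow (by linarith), zero_mul]; exact h0 _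

/-- integral of `F` along the needle -/
noncomputable def NI {E : Type*} [AddCommGroup E] [Module ℝ E] (F : E → ℝ≥0∞) (a b : E)
    (g : ℝ → ℝ) : ℝ≥0∞ := ∫⁻ t, F (a + t • b) * ENNReal.ofReal (g t)

def NeedleHyp {E : Type*} [AddCommGroup E] [Module ℝ E] (α β : ℝ) (F₁ F₂ F₃ F₄ : E → ℝ≥0∞) :
    Prop :=
  ∀ a b g, NiceLC g → NI F₃ a b g ≠ ⊤ → NI F₄ a b g ≠ ⊤ →
    NI F₁ a b g ^ α * NI F₂ a b g ^ β ≤ NI F₃ a b g ^ α * NI F₄ a b g ^ β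

def TT (α β : ℝ) (E : Type*) [AddCommGroup E] [Module ℝ E] [MeasureSpace E] : Prop :=
  ∀ F₁ F₂ F₃ F₄ : E → ℝ≥0∞, Measurable F₁ → Measurable F₂ → Measurable F₃ → Measurable F₄ →
    ∫⁻ x, F₃ x ≠ ⊤ → ∫⁻ x, F₄ x ≠ ⊤ → NeedleHyp α β F₁ F₂ F₃ F₄ →
    (∫⁻ x, F₁ x) ^ α * (∫⁻ x, F₂ x) ^ β ≤ (∫⁻ x, F₃ x) ^ α * (∫⁻ x, F₄ x) ^ β

theorem TT_transfer {α β : ℝ} {E E' : Type*} [AddCommGroup E] [Module ℝ E] [MeasureSpace E]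
    [AddCommGroup E'] [Module ℝ E'] [MeasureSpace E'] (σ : E' →ₗ[ℝ] E)
    (hσ : MeasurePreserving σ volume volume) (h : TT α β E') : TT α β E := by
  intro F₁ F₂ F₃ F₄ m₁ m₂ m₃ m₄ i₃ i₄ hN
  rw [← hσ.lintegral_comp m₁, ← hσ.lintegral_comp m₂, ← hσ.lintegral_comp m₃,
    ← hσ.lintegral_comp m₄]
  rw [← hσ.lintegral_comp m₃] at i₃
  rw [← hσ.lintegral_comp m₄] at i₄
  refine h (fun x => F₁ (σ x)) _ _ _ (m₁.comp hσ.measurable) (m₂.comp hσ.measurable)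
    (m₃.comp hσ.measurable) (m₄.comp hσ.measurable) i₃ i₄ ?_
  intro a b g hg
  have key : ∀ F : E → ℝ≥0∞, NI (fun x => F (σ x)) a b g = NI F (σ a) (σ b) g := by
    intro F; simp [NI]
  simp only [key]
  exact hN _ _ g hg

theorem rpow_lim_le {α β : ℝ} (hα : 0 < α) (hβ : 0 < β) {x y : ℕ → ℝ≥0∞} {a b c : ℝ≥0∞}
    (hx : Filter.Tendsto x Filter.atTop (nhds a)) (hy : Filter.Tendsto y Filter.atTop (nhds b))
    (h : ∀ k, x k ^ α * y k ^ β ≤ c) : a ^ α * b ^ β ≤ c := by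
  by_cases ha : a = 0
  · simp [ha, ENNReal.zero_rpow_of_pos hα]
  by_cases hb : b = 0
  · simp [hb, ENNReal.zero_rpow_of_pos hβ]
  refine le_of_tendsto' (ENNReal.Tendsto.mul ((ENNReal.continuous_rpow_const.tendsto a).comp hx)
    (Or.inl ?_) ((ENNReal.continuous_rpow_const.tendsto b).comp hy) (Or.inl ?_)) h
  · simp [ENNReal.rpow_eq_zero_iff, ha, hα, not_lt.2 hα.le]
  · simp [ENNReal.rpow_eq_zero_iff, hb, hβ, not_lt.2 hβ.le]

theorem tendsto_trunc {E : Type*} [MeasurableSpace E] (μ : Measure E) {F : ℕ → E → ℝ≥0∞}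
    {G : E → ℝ≥0∞} (hF : ∀ k, Measurable (F k)) (hmono : Monotone F)
    (hlim : ∀ x, ∀ y < G x, ∃ k, y ≤ F k x) (hle : ∀ k x, F k x ≤ G x) :
    Filter.Tendsto (fun k => ∫⁻ x, F k x ∂μ) Filter.atTop (nhds (∫⁻ x, G x ∂μ)) := by
  have : G = fun x => ⨆ k, F k x := by
    funext x
    refine le_antisymm ?_ (iSup_le fun k => hle k x)
    refine le_of_forall_lt fun y hy => ?_
    obtain ⟨z, hz, hz'⟩ := exists_between hy
    obtain ⟨k, hk⟩ := hlim x z hz'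
    exact hz.trans_le (hk.trans (le_iSup (fun k => F k x) k))
  rw [this, lintegral_iSup hF hmono]
  refine tendsto_atTop_iSup fun i j hij => lintegral_mono fun x => hmono hij x

theorem TT_base {α β : ℝ} (hα : 0 < α) (hβ : 0 < β) : TT α β ℝ := by
  intro F₁ F₂ F₃ F₄ m₁ m₂ m₃ m₄ i₃ i₄ hN
  set g : ℕ → ℝ → ℝ := fun k => (Set.Icc (-(k:ℝ)) k).indicator 1 with hgdef
  have hg : ∀ k, NiceLC (g k) := by
    intro k
    refine NiceLC.of_concave (S := Set.Icc (-(k:ℝ)) k) (Metric.isBounded_Icc _ _)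
      (measurable_one.indicator measurableSet_Icc)
      (fun x => Set.indicator_nonneg (by simp) x)
      ⟨1, fun x => Set.indicator_le_self' (by simp) x⟩ (fun x hx => Set.indicator_of_notMem hx _) ?_
    refine ⟨convex_Icc _ _, fun x hx y hy a b ha hb hab => ?_⟩
    have := (convex_Icc (-(k:ℝ)) k) hx hy ha hb hab
    simp only [hgdef]
    rw [Set.indicator_of_mem hx, Set.indicator_of_mem hy, Set.indicator_of_mem this]
    simp [hab]
  have key : ∀ (F : ℝ → ℝ≥0∞) k, NI F 0 1 (g k) = ∫⁻ x, (Set.Icc (-(k:ℝ)) k).indicator F x := by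
    intro F k
    simp only [NI, hgdef]
    refine lintegral_congr fun t => ?_
    by_cases ht : t ∈ Set.Icc (-(k:ℝ)) k
    · rw [Set.indicator_of_mem ht, Set.indicator_of_mem ht]; simp
    · rw [Set.indicator_of_notMem ht, Set.indicator_of_notMem ht]; simp
  have kle : ∀ (F : ℝ → ℝ≥0∞) k, NI F 0 1 (g k) ≤ ∫⁻ x, F x := by
    intro F k
    rw [key]
    exact lintegral_mono fun x => Set.indicator_le_self _ _ x
  have klim : ∀ (F : ℝ → ℝ≥0∞), Measurable F →
      Filter.Tendsto (fun k => NI F 0 1 (g k)) Filter.atTop (nhds (∫⁻ x, F x)) := by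
    intro F hF
    simp only [key]
    refine tendsto_trunc _ (fun k => hF.indicator measurableSet_Icc) ?_ ?_ ?_
    · intro i j hij x
      refine Set.indicator_le_indicator_of_subset (Set.Icc_subset_Icc ?_ ?_) (by simp) x
      · simpa using hij
      · simpa using hij
    · intro x y hy
      obtain ⟨k, hk⟩ := exists_nat_ge |x|
      refine ⟨k, ?_⟩
      rw [Set.indicator_of_mem (by exact abs_le.1 hk)]
      exact hy.le
    · intro k x; exact Set.indicator_le_self _ _ x
  refine rpow_lim_le hα hβ (klim F₁ m₁) (klim F₂ m₂) fun k => ?_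
  refine (hN 0 1 (g k) (hg k) (ne_top_of_le_ne_top i₃ (kle _ _))
    (ne_top_of_le_ne_top i₄ (kle _ _))).trans ?_
  gcongr
  · exact kle _ _
  · exact kle _ _

theorem NiceLC.mul_comp {g g' : ℝ → ℝ} (hg : NiceLC g) (hg' : NiceLC g') (p q : ℝ) :
    NiceLC (fun s => g (p + s * q) * g' s) := by
  obtain ⟨M, hM⟩ := hg.bdd
  obtain ⟨M', hM'⟩ := hg'.bdd
  obtain ⟨R', hR'⟩ := hg'.supp
  refine ⟨(hg.meas.comp (by fun_prop)).mul hg'.meas, fun x => mul_nonneg (hg.nonneg _)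
    (hg'.nonneg _), ⟨M * M', fun x => mul_le_mul (hM _) (hM' _) (hg'.nonneg _)
      ((hg.nonneg 0).trans (hM 0))⟩, ⟨R', fun x hx => by simp [hR' x hx]⟩, ?_⟩
  intro x y l hl hl1
  have h1 := hg.lc (p + x * q) (p + y * q) l hl hl1
  have h2 := hg'.lc x y l hl hl1
  rw [Real.mul_rpow (hg.nonneg _) (hg'.nonneg _), Real.mul_rpow (hg.nonneg _) (hg'.nonneg _)]
  have e : (1 - l) * (p + x * q) + l * (p + y * q) = p + ((1 - l) * x + l * y) * q := by ring
  rw [e] at h1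
  calc _ = (g (p + x * q) ^ (1 - l) * g (p + y * q) ^ l) * (g' x ^ (1 - l) * g' y ^ l) := by ring
    _ ≤ _ := mul_le_mul h1 h2 (mul_nonneg (Real.rpow_nonneg (hg'.nonneg _) _)
        (Real.rpow_nonneg (hg'.nonneg _) _)) (hg.nonneg _)

theorem TT_step {α β : ℝ} {P W : Type*} 
    [NormedAddCommGroup P] [NormedSpace ℝ P] [MeasureSpace P] [BorelSpace P]
    [SFinite (volume : Measure P)] [SecondCountableTopology P]
    [AddCommGroup W] [Module ℝ W] [MeasureSpace W]
    [SFinite (volume : Measure W)] (hP : TT α β P) (hW : TT α β (ℝ × W)) :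
    TT α β (P × W) := by
  intro F₁ F₂ F₃ F₄ m₁ m₂ m₃ m₄ i₃ i₄ hN
  have e : ∀ F : P × W → ℝ≥0∞, Measurable F → ∫⁻ x, F x = ∫⁻ y, ∫⁻ z, F (y, z) := by
    intro F hF
    rw [Measure.volume_eq_prod, lintegral_prod _ hF.aemeasurable]
  rw [e _ m₁, e _ m₂, e _ m₃, e _ m₄]
  rw [e _ m₃] at i₃
  rw [e _ m₄] at i₄
  refine hP (fun y => ∫⁻ z, F₁ (y, z)) (fun y => ∫⁻ z, F₂ (y, z)) (fun y => ∫⁻ z, F₃ (y, z))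
    (fun y => ∫⁻ z, F₄ (y, z)) m₁.lintegral_prod_right' m₂.lintegral_prod_right'
    m₃.lintegral_prod_right' m₄.lintegral_prod_right' i₃ i₄ ?_
  intro a b g hg
  have mm : ∀ F : P × W → ℝ≥0∞, Measurable F →
      Measurable (fun x : ℝ × W => F (a + x.1 • b, x.2) * ENNReal.ofReal (g x.1)) := by
    intro F hF
    refine (hF.comp ?_).mul ((hg.meas.comp measurable_fst).ennreal_ofReal)
    refine Measurable.prodMk ?_ measurable_snd
    have : Measurable (fun t : ℝ => a + t • b) := by fun_prop
    exact this.comp measurable_fst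
  have key : ∀ F : P × W → ℝ≥0∞, Measurable F → NI (fun y => ∫⁻ z, F (y, z)) a b g =
      ∫⁻ x : ℝ × W, F (a + x.1 • b, x.2) * ENNReal.ofReal (g x.1) := by
    intro F hF
    rw [Measure.volume_eq_prod, lintegral_prod _ (mm F hF).aemeasurable]
    refine lintegral_congr fun t => ?_
    dsimp only
    rw [lintegral_mul_const]
    exact hF.comp measurable_prodMk_left
  rw [key _ m₁, key _ m₂, key _ m₃, key _ m₄]
  intro j₃ j₄
  refine hW _ _ _ _ (mm _ m₁) (mm _ m₂) (mm _ m₃) (mm _ m₄) j₃ j₄ ?_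
  intro a' b' g' hg'
  have key2 : ∀ F : P × W → ℝ≥0∞, 
      NI (fun x : ℝ × W => F (a + x.1 • b, x.2) * ENNReal.ofReal (g x.1)) a' b' g' =
      NI F (a + a'.1 • b, a'.2) (b'.1 • b, b'.2) (fun s => g (a'.1 + s * b'.1) * g' s) := by
    intro F
    refine lintegral_congr fun s => ?_
    simp only [Prod.fst_add, Prod.snd_add, Prod.smul_fst, Prod.smul_snd, smul_eq_mul, Prod.mk_add_mk,
      Prod.smul_mk]
    rw [ENNReal.ofReal_mul (hg.nonneg _), mul_assoc, add_smul, mul_smul, add_assoc]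
  simp only [key2]
  exact hN _ _ _ (hg.mul_comp hg' _ _)

theorem TT_pi {α β : ℝ} (hα : 0 < α) (hβ : 0 < β) (hP : TT α β (ℝ × ℝ)) (n : ℕ) :
    TT α β (Fin (n + 1) → ℝ) := by
  induction n with
  | zero =>
    refine TT_transfer (E' := ℝ) (LinearMap.pi fun _ => LinearMap.id) ?_ (TT_base hα hβ)
    exact (volume_preserving_funUnique (Fin 1) ℝ).symm
  | succ n ih =>
    have c1 : TT α β (ℝ × (Fin n → ℝ)) := by
      have mp := volume_preserving_piFinSuccAbove (fun _ : Fin (n + 1) => ℝ) 0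
      refine TT_transfer (E' := Fin (n + 1) → ℝ)
        (LinearMap.prod (LinearMap.proj 0) (LinearMap.pi fun i => LinearMap.proj (Fin.succ i))) ?_ ih
      exact mp
    have c2 : TT α β ((ℝ × ℝ) × (Fin n → ℝ)) := TT_step hP c1
    have c3 : TT α β (ℝ × (ℝ × (Fin n → ℝ))) := by
      refine TT_transfer (LinearEquiv.prodAssoc ℝ ℝ ℝ (Fin n → ℝ)).toLinearMap ?_ c2
      exact volume_preserving_prodAssoc
    have mp1 := (volume_preserving_piFinSuccAbove (fun _ : Fin (n + 1) => ℝ) 0).symm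
    have mp2 := (volume_preserving_piFinSuccAbove (fun _ : Fin (n + 2) => ℝ) 0).symm
    have l1 : ∀ m : ℕ, ∃ σ : (ℝ × (Fin m → ℝ)) →ₗ[ℝ] (Fin (m + 1) → ℝ), ∀ x,
        σ x = (MeasurableEquiv.piFinSuccAbove (fun _ : Fin (m + 1) => ℝ) 0).symm x := by
      intro m
      refine ⟨⟨⟨fun x => Fin.cons x.1 x.2, ?_⟩, ?_⟩, ?_⟩
      · intro x y; funext i; refine Fin.cases ?_ (fun i => ?_) i <;> simp
      · intro c y; funext i; refine Fin.cases ?_ (fun i => ?_) i <;> simp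
      · intro x
        simp [MeasurableEquiv.piFinSuccAbove]
        rfl
    obtain ⟨σ1, h1⟩ := l1 n
    obtain ⟨σ2, h2⟩ := l1 (n + 1)
    have c4 : TT α β (ℝ × (Fin (n + 1) → ℝ)) := by
      refine TT_transfer (LinearMap.prodMap LinearMap.id σ1) ?_ c3
      have : MeasurePreserving σ1 volume volume := by
        rw [show (⇑σ1) = _ from funext h1]; exact mp1
      exact (MeasurePreserving.id _).prod this
    refine TT_transfer σ2 ?_ c4
    rw [show (⇑σ2) = _ from funext h2]; exact mp2


theorem concave_subseq {t0 t1 B : ℝ} (g : ℕ → ℝ → ℝ)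
    (hc : ∀ n, ConcaveOn ℝ (Set.Ioo t0 t1) (g n)) (h0 : ∀ n t, 0 ≤ g n t)
    (hB : ∀ n t, g n t ≤ B) : ∃ φ : ℕ → ℕ, StrictMono φ ∧ ∀ t ∈ Set.Ioo t0 t1, ∃ L,
      Tendsto (fun n => g (φ n) t) atTop (𝓝 L) := by
  have hs : IsCompact (Set.pi Set.univ (fun _ : ℚ => Set.Icc (0:ℝ) B)) :=
    isCompact_univ_pi fun _ => isCompact_Icc
  obtain ⟨l, -, φ, hφ, hlim⟩ := hs.tendsto_subseq (x := fun n (q : ℚ) => g n q)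
    (fun n q _ => ⟨h0 n q, hB n q⟩)
  refine ⟨φ, hφ, fun t ht => ?_⟩
  set r := min (t - t0) (t1 - t) with hr
  have hr0 : 0 < r := lt_min (by linarith [ht.1]) (by linarith [ht.2])
  have hball : Metric.ball t r ⊆ Set.Ioo t0 t1 := by
    intro x hx
    rw [Metric.mem_ball, Real.dist_eq, abs_lt] at hx
    have h1 := min_le_left (t - t0) (t1 - t)
    have h2 := min_le_right (t - t0) (t1 - t)
    constructor <;> linarith
  set K : NNReal := (2 * B / (r / 2)).toNNReal with hK
  have hLip : ∀ n, LipschitzOnWith K (-(g n)) (Metric.ball t (r - r / 2)) := by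
    intro n
    refine ConvexOn.lipschitzOnWith_of_abs_le (((hc n).subset hball (convex_ball _ _)).neg)
      (by positivity) fun a _ => ?_
    rw [Pi.neg_apply, abs_neg, abs_of_nonneg (h0 n a)]
    exact hB n a
  apply cauchySeq_tendsto_of_complete
  rw [Metric.cauchySeq_iff]
  intro ε hε
  have hδ : 0 < min (r / 2) (ε / (4 * (K + 1))) := lt_min (by positivity) (by positivity)
  obtain ⟨q, hq1, hq2⟩ := exists_rat_btwn (show t < t + min (r / 2) (ε / (4 * (K + 1))) by linarith)
  have hqd : dist t (q:ℝ) ≤ ε / (4 * (K + 1)) := by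
    rw [dist_comm, Real.dist_eq, abs_of_nonneg (by linarith)]
    linarith [min_le_right (r / 2) (ε / (4 * (K + 1)))]
  have hqr : (q:ℝ) ∈ Metric.ball t (r - r / 2) := by
    rw [Metric.mem_ball, Real.dist_eq, abs_of_nonneg (by linarith)]
    linarith [min_le_left (r / 2) (ε / (4 * (K + 1)))]
  have htr : t ∈ Metric.ball t (r - r / 2) := Metric.mem_ball_self (by linarith)
  have hqC : CauchySeq (fun n => g (φ n) q) := (tendsto_pi_nhds.1 hlim q).cauchySeq
  obtain ⟨N, hN⟩ := Metric.cauchySeq_iff.1 hqC (ε / 2) (by positivity)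
  refine ⟨N, fun m hm n hn => ?_⟩
  have hl : ∀ n, dist (g n t) (g n q) ≤ ε / 4 := by
    intro n
    have := (hLip n).dist_le_mul t htr q hqr
    rw [Pi.neg_apply, Pi.neg_apply, dist_neg_neg] at this
    refine this.trans ?_
    calc (K:ℝ) * dist t (q:ℝ) ≤ (K + 1) * (ε / (4 * (K + 1))) := by gcongr; linarith
      _ = ε / 4 := by field_simp
  have h1 := hl (φ m)
  have h2 := hl (φ n)
  rw [dist_comm] at h2
  have h3 := hN m hm n hn
  calc _ ≤ dist (g (φ m) t) (g (φ m) q) + dist (g (φ m) q) (g (φ n) q) + dist (g (φ n) q) (g (φ n) t) :=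
        dist_triangle4 _ _ _ _
    _ < ε := by linarith

def sec (K : Set (ℝ × ℝ)) (t : ℝ) : Set ℝ := Prod.mk t ⁻¹' K

theorem sec_compact {K : Set (ℝ × ℝ)} (hK : IsCompact K) (t : ℝ) : IsCompact (sec K t) := by
  have : sec K t = Prod.snd '' (K ∩ Prod.fst ⁻¹' {t}) := by
    ext s
    simp [sec]
  rw [this]
  exact (hK.inter_right (isClosed_singleton.preimage continuous_fst)).image continuous_snd

theorem sec_convex {K : Set (ℝ × ℝ)} (hK : Convex ℝ K) (t : ℝ) : Convex ℝ (sec K t) := by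
  intro x hx y hy a b ha hb hab
  have := hK hx hy ha hb hab
  simp only [Prod.smul_mk, Prod.mk_add_mk, smul_eq_mul, ← add_mul, hab, one_mul] at this
  exact this

theorem sec_Icc {K : Set (ℝ × ℝ)} (hc : IsCompact K) (hK : Convex ℝ K) (t : ℝ)
    (hne : (sec K t).Nonempty) : ∃ a b, a ≤ b ∧ sec K t = Set.Icc a b := by
  have h1 := eq_Icc_of_connected_compact ⟨hne, (sec_convex hK t).isPreconnected⟩ (sec_compact hc t)
  refine ⟨_, _, ?_, h1⟩
  rw [h1] at hne
  exact Set.nonempty_Icc.1 hne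

noncomputable def wid (K : Set (ℝ × ℝ)) (t : ℝ) : ℝ := (volume (sec K t)).toReal

theorem wid_ofReal {K : Set (ℝ × ℝ)} (hc : IsCompact K) (t : ℝ) :
    ENNReal.ofReal (wid K t) = volume (sec K t) :=
  ENNReal.ofReal_toReal (sec_compact hc t).measure_lt_top.ne

theorem wid_concave {K : Set (ℝ × ℝ)} (hc : IsCompact K) (hK : Convex ℝ K) {x y : ℝ}
    (hx : (sec K x).Nonempty) (hy : (sec K y).Nonempty) {a b : ℝ} (ha : 0 ≤ a) (hb : 0 ≤ b)
    (hab : a + b = 1) : a * wid K x + b * wid K y ≤ wid K (a * x + b * y) := by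
  obtain ⟨a1, b1, h1, e1⟩ := sec_Icc hc hK x hx
  obtain ⟨a2, b2, h2, e2⟩ := sec_Icc hc hK y hy
  have m : ∀ s1 s2, s1 ∈ sec K x → s2 ∈ sec K y → a * s1 + b * s2 ∈ sec K (a * x + b * y) := by
    intro s1 s2 hs1 hs2
    have := hK hs1 hs2 ha hb hab
    simpa [sec] using this
  have m1 := m a1 a2 (by rw [e1]; exact ⟨le_rfl, h1⟩) (by rw [e2]; exact ⟨le_rfl, h2⟩)
  have m2 := m b1 b2 (by rw [e1]; exact ⟨h1, le_rfl⟩) (by rw [e2]; exact ⟨h2, le_rfl⟩)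
  have hsub : Set.Icc (a * a1 + b * a2) (a * b1 + b * b2) ⊆ sec K (a * x + b * y) :=
    (sec_convex hK _).ordConnected.out m1 m2
  have := ENNReal.toReal_mono (sec_compact hc _).measure_lt_top.ne (measure_mono (μ := volume) hsub)
  have n1 : a * a1 ≤ a * b1 := mul_le_mul_of_nonneg_left h1 ha
  have n2 : b * a2 ≤ b * b2 := mul_le_mul_of_nonneg_left h2 hb
  rw [Real.volume_Icc, ENNReal.toReal_ofReal (by linarith)] at this
  have w1 : wid K x = b1 - a1 := by
    rw [wid, e1, Real.volume_Icc, ENNReal.toReal_ofReal (by linarith)]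
  have w2 : wid K y = b2 - a2 := by
    rw [wid, e2, Real.volume_Icc, ENNReal.toReal_ofReal (by linarith)]
  rw [w1, w2]
  refine le_trans (le_of_eq ?_) this
  ring

theorem lint_sec {K : Set (ℝ × ℝ)} (hc : IsCompact K) {G : ℝ × ℝ → ℝ≥0∞} (hG : Measurable G) :
    ∫⁻ x in K, G x = ∫⁻ t, ∫⁻ s in sec K t, G (t, s) := by
  rw [← lintegral_indicator hc.measurableSet, Measure.volume_eq_prod,
    lintegral_prod _ (hG.indicator hc.measurableSet).aemeasurable]
  refine lintegral_congr fun t => ?_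
  rw [← lintegral_indicator (sec_compact hc t).measurableSet]
  rfl

theorem vol_sec {K : Set (ℝ × ℝ)} (hc : IsCompact K) :
    volume K = ∫⁻ t, ENNReal.ofReal (wid K t) := by
  have := lint_sec hc (G := fun _ => 1) measurable_const
  simp only [lintegral_const, Measure.restrict_apply_univ, one_mul] at this
  rw [this]
  exact lintegral_congr fun t => (wid_ofReal hc t).symm

theorem wid_meas {K : Set (ℝ × ℝ)} (hc : IsCompact K) : Measurable (wid K) :=
  (measurable_measure_prodMk_left hc.measurableSet).ennreal_toReal

theorem wid_bound {K : Set (ℝ × ℝ)} (hc : IsCompact K) (hK : Convex ℝ K) {t0 t1 : ℝ} (h01 : t0 < t1)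
    (hne : ∀ x ∈ Set.Icc t0 t1, (sec K x).Nonempty) (t : ℝ) :
    wid K t ≤ 4 / (t1 - t0) * (volume K).toReal := by
  have hd : 0 < t1 - t0 := by linarith
  by_cases ht : (sec K t).Nonempty
  · have hw : 0 ≤ wid K t := ENNReal.toReal_nonneg
    have h1 : ENNReal.ofReal (wid K t / 2) * ENNReal.ofReal ((t1 - t0) / 2) ≤ volume K := by
      rw [vol_sec hc]
      have : ENNReal.ofReal (wid K t / 2) * ENNReal.ofReal ((t1 - t0) / 2) =
          ∫⁻ u in Set.Icc ((t + t0) / 2) ((t + t1) / 2), ENNReal.ofReal (wid K t / 2) := by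
        rw [lintegral_const, Measure.restrict_apply_univ, Real.volume_Icc]
        congr 2; ring
      rw [this]
      refine le_trans (setLIntegral_mono ((wid_meas hc).ennreal_ofReal) ?_) (setLIntegral_le_lintegral _ _)
      intro u hu
      apply ENNReal.ofReal_le_ofReal
      have hx : 2 * u - t ∈ Set.Icc t0 t1 := ⟨by linarith [hu.1], by linarith [hu.2]⟩
      have := wid_concave hc hK ht (hne _ hx) (a := 1/2) (b := 1/2) (by norm_num) (by norm_num)
        (by norm_num)
      have e : 1 / 2 * t + 1 / 2 * (2 * u - t) = u := by ring
      rw [e] at this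
      have hw2 : 0 ≤ wid K (2 * u - t) := ENNReal.toReal_nonneg
      linarith
    have h2 := ENNReal.toReal_mono hc.measure_lt_top.ne h1
    rw [ENNReal.toReal_mul, ENNReal.toReal_ofReal (by positivity),
      ENNReal.toReal_ofReal (by positivity)] at h2
    rw [div_mul_eq_mul_div, le_div_iff₀ hd]
    linarith
  · rw [Set.not_nonempty_iff_eq_empty] at ht
    simp only [wid, ht, measure_empty, ENNReal.toReal_zero]
    positivity


theorem ev_sub {X : Type*} [TopologicalSpace X] [T2Space X] {K : ℕ → Set X} (hanti : Antitone K)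
    (hc : ∀ n, IsCompact (K n)) {U : Set X} (hU : IsOpen U) (h : (⋂ n, K n) ⊆ U) :
    ∀ᶠ n in atTop, K n ⊆ U := by
  obtain ⟨i, hi⟩ := exists_subset_nhds_of_isCompact' (V := K) hanti.directed_ge hc
    (fun n => (hc n).isClosed) (U := U) (fun x hx => hU.mem_nhds (h hx))
  filter_upwards [eventually_ge_atTop i] with n hn
  exact (hanti hn).trans hi

theorem NiceLC_one : NiceLC ((Set.Icc (0:ℝ) 1).indicator 1) := by
  refine NiceLC.of_concave (S := Set.Icc (0:ℝ) 1) (Metric.isBounded_Icc _ _)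
    (measurable_one.indicator measurableSet_Icc)
    (fun x => Set.indicator_nonneg (by simp) x)
    ⟨1, fun x => Set.indicator_le_self' (by simp) x⟩ (fun x hx => Set.indicator_of_notMem hx _) ?_
  refine ⟨convex_Icc _ _, fun x hx y hy a b ha hb hab => ?_⟩
  have := (convex_Icc (0:ℝ) 1) hx hy ha hb hab
  rw [Set.indicator_of_mem hx, Set.indicator_of_mem hy, Set.indicator_of_mem this]
  simp [hab]

theorem int_one : ∫⁻ t, ENNReal.ofReal ((Set.Icc (0:ℝ) 1).indicator 1 t) = 1 := by
  have : ∀ t, ENNReal.ofReal ((Set.Icc (0:ℝ) 1).indicator 1 t) =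
      (Set.Icc (0:ℝ) 1).indicator 1 t := by
    intro t
    by_cases ht : t ∈ Set.Icc (0:ℝ) 1
    · rw [Set.indicator_of_mem ht, Set.indicator_of_mem ht]; simp
    · rw [Set.indicator_of_notMem ht, Set.indicator_of_notMem ht]; simp
  simp only [this]
  rw [lintegral_indicator_one measurableSet_Icc]
  simp

theorem lim_point {K : ℕ → Set (ℝ × ℝ)} (hanti : Antitone K) (hc : ∀ n, IsCompact (K n))
    (hpos : ∀ n, 0 < volume (K n)) (p : ℝ × ℝ) (hp : (⋂ n, K n) ⊆ {p}) {G : ℝ × ℝ → ℝ≥0∞}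
    (hG : LowerSemicontinuous G) :
    NI G p 0 ((Set.Icc (0:ℝ) 1).indicator 1) ≤
      liminf (fun n => (∫⁻ x in K n, G x) / volume (K n)) atTop := by
  have e : NI G p 0 ((Set.Icc (0:ℝ) 1).indicator 1) = G p := by
    simp only [NI, smul_zero, add_zero]
    rw [lintegral_const_mul, int_one, mul_one]
    exact NiceLC_one.meas.ennreal_ofReal
  rw [e]
  refine le_of_forall_lt fun y hy => ?_
  obtain ⟨z, hz, hz'⟩ := exists_between hy
  refine hz.trans_le (le_liminf_of_le (by isBoundedDefault) ?_)
  filter_upwards [ev_sub hanti hc (hG.isOpen_preimage z) (hp.trans (by simpa using hz'))] with n hn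
  rw [ENNReal.le_div_iff_mul_le (Or.inl (hpos n).ne') (Or.inl (hc n).measure_lt_top.ne)]
  calc z * volume (K n) = ∫⁻ x in K n, z := by simp
    _ ≤ _ := setLIntegral_mono hG.measurable fun x hx => (hn hx).le

theorem lim_seg {K : ℕ → Set (ℝ × ℝ)} (hanti : Antitone K) (hc : ∀ n, IsCompact (K n))
    (hK : ∀ n, Convex ℝ (K n)) (hpos : ∀ n, 0 < volume (K n)) (m k t0 t1 : ℝ) (h01 : t0 < t1)
    (hline : ∀ x ∈ ⋂ n, K n, x.2 = m * x.1 + k) 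
    (hproj : Prod.fst '' (⋂ n, K n) = Set.Icc t0 t1) :
    ∃ φ : ℕ → ℕ, StrictMono φ ∧ ∃ g, NiceLC g ∧ ∫⁻ t, ENNReal.ofReal (g t) = 1 ∧
      ∀ G : ℝ × ℝ → ℝ≥0∞, LowerSemicontinuous G → NI G (0, k) (1, m) g ≤
      liminf (fun n => (∫⁻ x in K (φ n), G x) / volume (K (φ n))) atTop := by
  set V : ℕ → ℝ := fun n => (volume (K n)).toReal with hV
  have hVpos : ∀ n, 0 < V n := fun n => ENNReal.toReal_pos (hpos n).ne' (hc n).measure_lt_top.ne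
  have hVo : ∀ n, ENNReal.ofReal (V n) = volume (K n) := fun n =>
    ENNReal.ofReal_toReal (hc n).measure_lt_top.ne
  have hne : ∀ n, ∀ x ∈ Set.Icc t0 t1, (sec (K n) x).Nonempty := by
    intro n x hx
    rw [← hproj] at hx
    obtain ⟨y, hy, rfl⟩ := hx
    exact ⟨y.2, Set.mem_iInter.1 hy n⟩
  set w : ℕ → ℝ → ℝ := fun n t => wid (K n) t / V n with hw
  set B := 4 / (t1 - t0) with hB
  have w0 : ∀ n t, 0 ≤ w n t := fun n t => div_nonneg ENNReal.toReal_nonneg (hVpos n).le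
  have wB : ∀ n t, w n t ≤ B := by
    intro n t
    rw [hw, div_le_iff₀ (hVpos n)]
    exact wid_bound (hc n) (hK n) h01 (hne n) t
  have wconc : ∀ n, ConcaveOn ℝ (Set.Ioo t0 t1) (w n) := by
    intro n
    refine ⟨convex_Ioo _ _, fun x hx y hy a b ha hb hab => ?_⟩
    have := wid_concave (hc n) (hK n) (hne n x (Set.Ioo_subset_Icc_self hx))
      (hne n y (Set.Ioo_subset_Icc_self hy)) ha hb hab
    simp only [hw, smul_eq_mul]
    rw [← mul_div_assoc, ← mul_div_assoc, ← add_div]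
    exact div_le_div_of_nonneg_right this (hVpos n).le
  have wmeas : ∀ n, Measurable (w n) := fun n => (wid_meas (hc n)).div_const _
  obtain ⟨φ, hφ, hL⟩ := concave_subseq w wconc w0 wB
  choose! L hL using hL
  set g : ℝ → ℝ := (Set.Ioo t0 t1).indicator L with hg
  have hKφ : Antitone (fun n => K (φ n)) := fun i j hij => hanti (hφ.monotone hij)
  have hIφ : (⋂ n, K (φ n)) = ⋂ n, K n := by
    refine le_antisymm ?_ ?_
    · intro x hx
      rw [Set.mem_iInter] at hx ⊢
      exact fun n => hanti (hφ.id_le n) (hx n)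
    · intro x hx
      rw [Set.mem_iInter] at hx ⊢
      exact fun n => hx _
  have hout : ∀ t, t ∉ Set.Icc t0 t1 → ∀ᶠ n in atTop, w (φ n) t = 0 := by
    intro t ht
    have := ev_sub hKφ (fun n => hc (φ n)) (U := Prod.fst ⁻¹' {t}ᶜ)
      (isOpen_compl_singleton.preimage continuous_fst) (by
        rw [hIφ]
        intro x hx hxt
        apply ht
        rw [← hproj]
        exact ⟨x, hx, hxt⟩)
    filter_upwards [this] with n hn
    have : sec (K (φ n)) t = ∅ := by
      rw [Set.eq_empty_iff_forall_notMem]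
      intro s hs
      exact hn hs rfl
    simp [hw, wid, this]
  have hlim : ∀ t, t ≠ t0 → t ≠ t1 → Tendsto (fun n => w (φ n) t) atTop (𝓝 (g t)) := by
    intro t h0 h1
    by_cases ht : t ∈ Set.Ioo t0 t1
    · rw [hg, Set.indicator_of_mem ht]; exact hL t ht
    · rw [hg, Set.indicator_of_notMem ht]
      refine tendsto_const_nhds.congr' ?_
      have : t ∉ Set.Icc t0 t1 := fun h => ht ⟨lt_of_le_of_ne h.1 h0.symm, lt_of_le_of_ne h.2 h1⟩
      filter_upwards [hout t this] with n hn using hn.symm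
  have gmeas : Measurable g := by
    refine measurable_of_tendsto_metrizable (f := fun n => (Set.Ioo t0 t1).indicator (w (φ n)))
      (fun n => (wmeas _).indicator measurableSet_Ioo) ?_
    rw [tendsto_pi_nhds]
    intro t
    by_cases ht : t ∈ Set.Ioo t0 t1
    · simp only [hg, Set.indicator_of_mem ht]; exact hL t ht
    · simp only [hg, Set.indicator_of_notMem ht]; exact tendsto_const_nhds
  have L0 : ∀ t ∈ Set.Ioo t0 t1, 0 ≤ L t := fun t ht =>
    ge_of_tendsto' (hL t ht) fun n => w0 _ _
  have B0 : 0 ≤ B := (w0 0 0).trans (wB 0 0)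
  have gnice : NiceLC g := by
    refine NiceLC.of_concave (S := Set.Ioo t0 t1) (Metric.isBounded_Ioo _ _) gmeas
      (fun x => Set.indicator_apply_nonneg (L0 x)) ⟨B, fun x => ?_⟩
      (fun x hx => Set.indicator_of_notMem hx _) ⟨convex_Ioo _ _, ?_⟩
    · exact Set.indicator_apply_le' (fun hx => le_of_tendsto' (hL x hx) fun n => wB _ _)
        (fun _ => B0)
    · intro x hx y hy a b ha hb hab
      have hz := convex_Ioo t0 t1 hx hy ha hb hab
      rw [hg, Set.indicator_of_mem hx, Set.indicator_of_mem hy, Set.indicator_of_mem hz]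
      refine le_of_tendsto_of_tendsto' (((hL x hx).const_smul a).add ((hL y hy).const_smul b))
        (hL _ hz) fun n => ?_
      exact (wconc (φ n)).2 hx hy ha hb hab
  have hae : ∀ᵐ t : ℝ, t ≠ t0 ∧ t ≠ t1 := by
    have h1 : ∀ᵐ t : ℝ, t ≠ t0 := by simp [ae_iff]
    have h2 : ∀ᵐ t : ℝ, t ≠ t1 := by simp [ae_iff]
    filter_upwards [h1, h2] with t a b using ⟨a, b⟩
  refine ⟨φ, hφ, g, gnice, ?_, ?_⟩
  · have h1 : ∀ n, ∫⁻ t, ENNReal.ofReal (w (φ n) t) = 1 := by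
      intro n
      have : ∀ t, ENNReal.ofReal (w (φ n) t) =
          ENNReal.ofReal (wid (K (φ n)) t) * (volume (K (φ n)))⁻¹ := by
        intro t
        rw [hw, ENNReal.ofReal_div_of_pos (hVpos _), hVo, div_eq_mul_inv]
      simp only [this]
      rw [lintegral_mul_const _ (wid_meas (hc _)).ennreal_ofReal, ← vol_sec (hc _)]
      exact ENNReal.mul_inv_cancel (hpos _).ne' (hc _).measure_lt_top.ne
    have h2 := tendsto_lintegral_of_dominated_convergence (μ := volume)
      (F := fun n t => ENNReal.ofReal (w (φ n) t)) (f := fun t => ENNReal.ofReal (g t))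
      ((Prod.fst '' (K 0)).indicator fun _ => ENNReal.ofReal B)
      (fun n => (wmeas _).ennreal_ofReal) (fun n => ae_of_all _ fun t => ?_) ?_ ?_
    · simp only [h1] at h2
      exact (tendsto_nhds_unique h2 tendsto_const_nhds)
    · by_cases ht : t ∈ Prod.fst '' (K 0)
      · rw [Set.indicator_of_mem ht]; exact ENNReal.ofReal_le_ofReal (wB _ _)
      · have : sec (K (φ n)) t = ∅ := by
          rw [Set.eq_empty_iff_forall_notMem]
          intro s hs
          exact ht ⟨(t, s), hanti (Nat.zero_le _) hs, rfl⟩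
        simp [hw, wid, this]
    · have hcc := (hc 0).image (continuous_fst (X := ℝ) (Y := ℝ))
      rw [lintegral_indicator hcc.measurableSet, lintegral_const, Measure.restrict_apply_univ]
      exact ENNReal.mul_ne_top ENNReal.ofReal_ne_top hcc.measure_lt_top.ne
    · filter_upwards [hae] with t ht
      exact ENNReal.tendsto_ofReal (hlim t ht.1 ht.2)
  · intro G hG
    have hGm := hG.measurable
    have e : ∀ n, (∫⁻ x in K (φ n), G x) / volume (K (φ n)) =
        ∫⁻ t, (∫⁻ s in sec (K (φ n)) t, G (t, s)) / volume (K (φ n)) := by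
      intro n
      simp only [div_eq_mul_inv]
      rw [lint_sec (hc _) hGm, lintegral_mul_const']
      exact ENNReal.inv_ne_top.2 (hpos _).ne'
    simp only [e]
    refine le_trans ?_ (lintegral_liminf_le fun n => ?_)
    · refine lintegral_mono fun t => ?_
      by_cases ht : t ∈ Set.Ioo t0 t1
      swap
      · simp [hg, Set.indicator_of_notMem ht]
      refine ENNReal.mul_le_of_forall_lt fun y hy z hz => ?_
      have hsec : ∀ᶠ n in atTop, sec (K (φ n)) t ⊆ {s | y < G (t, s)} := by
        refine ev_sub (K := fun n => sec (K (φ n)) t)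
          (fun i j hij => Set.preimage_mono (hKφ hij)) (fun n => sec_compact (hc _) _) ?_ ?_
        · exact (hG.isOpen_preimage y).preimage (Continuous.prodMk_right t)
        · intro s hs
          have : (t, s) ∈ ⋂ n, K n := by
            rw [← hIφ]
            exact Set.mem_iInter.2 fun n => Set.mem_iInter.1 hs n
          have h2 := hline _ this
          simp only at h2
          have e2 : ((0:ℝ), k) + t • ((1:ℝ), m) = (t, s) := by
            rw [h2]; ext <;> simp; ring
          rw [e2] at hy
          exact hy
      have hlt : ∀ᶠ n in atTop, z < ENNReal.ofReal (w (φ n) t) :=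
        (ENNReal.tendsto_ofReal (hlim t ht.1.ne' ht.2.ne)).eventually_const_lt hz
      refine le_liminf_of_le (by isBoundedDefault) ?_
      filter_upwards [hsec, hlt] with n hn1 hn2
      rw [ENNReal.le_div_iff_mul_le (Or.inl (hpos _).ne') (Or.inl (hc _).measure_lt_top.ne)]
      calc y * z * volume (K (φ n)) ≤ y * ENNReal.ofReal (w (φ n) t) * volume (K (φ n)) := by gcongr
        _ = y * volume (sec (K (φ n)) t) := by
          rw [hw, ENNReal.ofReal_div_of_pos (hVpos _), hVo, mul_assoc, wid_ofReal (hc _),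
            ENNReal.div_mul_cancel (hpos _).ne' (hc _).measure_lt_top.ne]
        _ = ∫⁻ s in sec (K (φ n)) t, y := by simp
        _ ≤ _ := setLIntegral_mono (hGm.comp measurable_prodMk_left) fun x hx => (hn1 hx).le
    · refine Measurable.div_const ?_ _
      have h1 := (hGm.indicator (hc (φ n)).measurableSet).lintegral_prod_right' (ν := (volume : Measure ℝ))
      have h2 : (fun t => ∫⁻ s in sec (K (φ n)) t, G (t, s)) =
          fun t => ∫⁻ s, (K (φ n)).indicator G (t, s) := by
        funext t
        rw [← lintegral_indicator (sec_compact (hc _) t).measurableSet]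
        rfl
      rw [h2]
      exact h1

theorem lim_line {K : ℕ → Set (ℝ × ℝ)} (hanti : Antitone K) (hc : ∀ n, IsCompact (K n))
    (hK : ∀ n, Convex ℝ (K n)) (hpos : ∀ n, 0 < volume (K n)) (m k : ℝ)
    (hline : ∀ x ∈ ⋂ n, K n, x.2 = m * x.1 + k) :
    ∃ φ : ℕ → ℕ, StrictMono φ ∧ ∃ a b g, NiceLC g ∧ ∫⁻ t, ENNReal.ofReal (g t) = 1 ∧
      ∀ G : ℝ × ℝ → ℝ≥0∞, LowerSemicontinuous G → NI G a b g ≤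
      liminf (fun n => (∫⁻ x in K (φ n), G x) / volume (K (φ n))) atTop := by
  have hne : (⋂ n, K n).Nonempty :=
    IsCompact.nonempty_iInter_of_directed_nonempty_isCompact_isClosed K hanti.directed_ge
      (fun n => nonempty_of_measure_ne_zero (hpos n).ne') hc (fun n => (hc n).isClosed)
  have hcc : IsCompact (⋂ n, K n) := (hc 0).of_isClosed_subset
    (isClosed_iInter fun n => (hc n).isClosed) (Set.iInter_subset _ 0)
  have hconv : Convex ℝ (⋂ n, K n) := convex_iInter hK
  have hproj := eq_Icc_of_connected_compact (s := Prod.fst '' (⋂ n, K n))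
    ⟨hne.image _, (hconv.isPreconnected.image _ continuous_fst.continuousOn)⟩
    (hcc.image continuous_fst)
  set t0 := sInf (Prod.fst '' (⋂ n, K n))
  set t1 := sSup (Prod.fst '' (⋂ n, K n))
  have h01 : t0 ≤ t1 := by
    have := hne.image (Prod.fst (α := ℝ) (β := ℝ))
    rw [hproj] at this
    exact Set.nonempty_Icc.1 this
  rcases h01.lt_or_eq with h | h
  · obtain ⟨φ, hφ, g, h1⟩ := lim_seg hanti hc hK hpos m k t0 t1 h hline hproj
    exact ⟨φ, hφ, _, _, g, h1⟩
  · refine ⟨id, strictMono_id, (t0, m * t0 + k), 0, _, NiceLC_one, int_one, fun G hG => ?_⟩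
    refine lim_point hanti hc hpos _ ?_ hG
    intro x hx
    have h1 : x.1 ∈ Prod.fst '' (⋂ n, K n) := ⟨x, hx, rfl⟩
    rw [hproj, h, Set.Icc_self, Set.mem_singleton_iff, ← h] at h1
    have := hline x hx
    rw [h1] at this
    exact Prod.ext h1 this

theorem lim_full {K : ℕ → Set (ℝ × ℝ)} (hanti : Antitone K) (hc : ∀ n, IsCompact (K n))
    (hK : ∀ n, Convex ℝ (K n)) (hpos : ∀ n, 0 < volume (K n))
    (hint : interior (⋂ n, K n) = ∅) :
    ∃ φ : ℕ → ℕ, StrictMono φ ∧ ∃ a b g, NiceLC g ∧ ∫⁻ t, ENNReal.ofReal (g t) = 1 ∧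
      ∀ G : ℝ × ℝ → ℝ≥0∞, LowerSemicontinuous G → NI G a b g ≤
      liminf (fun n => (∫⁻ x in K (φ n), G x) / volume (K (φ n))) atTop := by
  have hne : (⋂ n, K n).Nonempty :=
    IsCompact.nonempty_iInter_of_directed_nonempty_isCompact_isClosed K hanti.directed_ge
      (fun n => nonempty_of_measure_ne_zero (hpos n).ne') hc (fun n => (hc n).isClosed)
  have hconv : Convex ℝ (⋂ n, K n) := convex_iInter hK
  have hspan : affineSpan ℝ (⋂ n, K n) ≠ ⊤ := by
    intro h
    rw [← hconv.interior_nonempty_iff_affineSpan_eq_top, hint] at h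
    exact Set.not_nonempty_empty h
  obtain ⟨x0, hx0⟩ := hne
  have hdir : (affineSpan ℝ (⋂ n, K n)).direction < ⊤ := by
    rw [lt_top_iff_ne_top]
    intro h
    apply hspan
    rwa [AffineSubspace.direction_eq_top_iff_of_nonempty ⟨x0, subset_affineSpan ℝ _ hx0⟩] at h
  obtain ⟨f, hf0, hf⟩ := Submodule.exists_le_ker_of_lt_top _ hdir
  have hfc : ∀ x ∈ ⋂ n, K n, f x = f x0 := by
    intro x hx
    have : x - x0 ∈ (affineSpan ℝ (⋂ n, K n)).direction := by
      rw [← vsub_eq_sub]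
      exact AffineSubspace.vsub_mem_direction (subset_affineSpan ℝ _ hx) (subset_affineSpan ℝ _ hx0)
    have := hf this
    rw [LinearMap.mem_ker, map_sub] at this
    linarith
  have hfx : ∀ x : ℝ × ℝ, f x = x.1 * f (1, 0) + x.2 * f (0, 1) := by
    intro x
    have : x = x.1 • ((1:ℝ), (0:ℝ)) + x.2 • ((0:ℝ), (1:ℝ)) := by ext <;> simp
    conv_lhs => rw [this]
    rw [map_add, map_smul, map_smul, smul_eq_mul, smul_eq_mul]
  by_cases hq : f (0, 1) = 0
  swap
  · refine lim_line hanti hc hK hpos (- f (1, 0) / f (0, 1)) (f x0 / f (0, 1)) fun x hx => ?_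
    have := hfc x hx
    rw [hfx x] at this
    field_simp
    linarith
  · have hp : f (1, 0) ≠ 0 := by
      intro hp
      apply hf0
      ext <;> simp [hp, hq]
    have mp : MeasurePreserving (Prod.swap : ℝ × ℝ → ℝ × ℝ) volume volume :=
      Measure.measurePreserving_swap
    have me : MeasurableEmbedding (Prod.swap : ℝ × ℝ → ℝ × ℝ) :=
      MeasurableEquiv.prodComm.measurableEmbedding
    have hvol : ∀ n, volume (Prod.swap ⁻¹' (K n)) = volume (K n) := fun n =>
      mp.measure_preimage (hc n).measurableSet.nullMeasurableSet
    obtain ⟨φ, hφ, a, b, g, hg, hg1, hG⟩ := lim_line (K := fun n => Prod.swap ⁻¹' (K n))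
      (fun i j hij => Set.preimage_mono (hanti hij))
      (fun n => (Homeomorph.prodComm ℝ ℝ).isCompact_preimage.2 (hc n))
      (fun n => (hK n).linear_preimage (LinearEquiv.prodComm ℝ ℝ ℝ).toLinearMap)
      (fun n => by rw [hvol]; exact hpos n)
      0 (f x0 / f (1, 0)) (by
        intro x hx
        have hx' : x.swap ∈ ⋂ n, K n := by
          rw [Set.mem_iInter] at hx ⊢
          exact fun n => hx n
        have := hfc _ hx'
        rw [hfx, hq] at this
        simp only [Prod.fst_swap] at this
        field_simp
        linarith)
    refine ⟨φ, hφ, a.swap, b.swap, g, hg, hg1, fun G hGl => ?_⟩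
    have := hG (fun x => G x.swap) (hGl.comp continuous_swap)
    simp only [hvol] at this
    refine le_trans (le_of_eq ?_) (this.trans (le_of_eq ?_))
    · rfl
    · congr 1
      funext n
      rw [mp.setLIntegral_comp_preimage (hc _).measurableSet hGl.measurable]


noncomputable def lf (p : ℝ × ℝ) (θ : ℝ) (x : ℝ × ℝ) : ℝ :=
  Real.cos θ * (x.1 - p.1) + Real.sin θ * (x.2 - p.2)

def HP (p : ℝ × ℝ) (θ : ℝ) : Set (ℝ × ℝ) := {x | 0 ≤ lf p θ x}

theorem lf_cont (p : ℝ × ℝ) (θ : ℝ) : Continuous (lf p θ) := by unfold lf; fun_prop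

theorem HP_closed (p : ℝ × ℝ) (θ : ℝ) : IsClosed (HP p θ) :=
  isClosed_le continuous_const (lf_cont p θ)

theorem HP_convex (p : ℝ × ℝ) (θ : ℝ) : Convex ℝ (HP p θ) := by
  intro x hx y hy a b ha hb hab
  simp only [HP, Set.mem_ofPred_eq] at *
  have : lf p θ (a • x + b • y) = a * lf p θ x + b * lf p θ y := by
    have hb' : b = 1 - a := by linarith
    subst hb'
    simp only [lf, Prod.fst_add, Prod.snd_add, Prod.smul_fst, Prod.smul_snd, smul_eq_mul]
    ring
  rw [this]; positivity

theorem lf_pi (p : ℝ × ℝ) (θ : ℝ) (x : ℝ × ℝ) : lf p (θ + Real.pi) x = - lf p θ x := by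
  simp only [lf, Real.cos_add_pi, Real.sin_add_pi]; ring

theorem lf_move (p : ℝ × ℝ) (θ s : ℝ) : lf p θ (p + s • (Real.cos θ, Real.sin θ)) = s := by
  simp only [lf, Prod.fst_add, Prod.snd_add, Prod.smul_fst, Prod.smul_snd, smul_eq_mul]
  have := Real.cos_sq_add_sin_sq θ
  linear_combination s * this

theorem line_null (p : ℝ × ℝ) (θ : ℝ) : volume {x | lf p θ x = 0} = 0 := by
  let f : ℝ × ℝ →ₗ[ℝ] ℝ := Real.cos θ • LinearMap.fst ℝ ℝ ℝ + Real.sin θ • LinearMap.snd ℝ ℝ ℝ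
  have hf : LinearMap.ker f ≠ ⊤ := by
    intro h
    have : ((Real.cos θ, Real.sin θ) : ℝ × ℝ) ∈ LinearMap.ker f := by rw [h]; trivial
    rw [LinearMap.mem_ker] at this
    simp only [f, LinearMap.add_apply, LinearMap.smul_apply, LinearMap.fst_apply,
      LinearMap.snd_apply, smul_eq_mul] at this
    nlinarith [Real.cos_sq_add_sin_sq θ]
  have h0 := Measure.addHaar_submodule (volume : Measure (ℝ × ℝ)) _ hf
  have : {x | lf p θ x = 0} = (fun x => x + (-p)) ⁻¹' (LinearMap.ker f : Set (ℝ × ℝ)) := by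
    ext x
    simp [lf, f, sub_eq_add_neg]
  rw [this, measure_preimage_add_right, h0]

theorem HP_cont {m : Measure (ℝ × ℝ)} [IsFiniteMeasure m] (hm : m ≪ volume) (p : ℝ × ℝ) : Continuous (fun θ => m.real (HP p θ)) := by
  have e : (fun θ => m.real (HP p θ)) = fun θ => ∫ x, (HP p θ).indicator (fun _ => (1:ℝ)) x ∂m := by
    funext θ
    rw [integral_indicator_const _ (HP_closed p θ).measurableSet]; simp
  rw [e, continuous_iff_continuousAt]
  intro θ
  refine continuousAt_of_dominated (bound := fun _ => 1) ?_ ?_ (integrable_const _) ?_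
  · exact Eventually.of_forall fun θ =>
      (measurable_const.indicator (HP_closed p θ).measurableSet).aestronglyMeasurable
  · refine Eventually.of_forall fun θ => ae_of_all _ fun x => ?_
    by_cases hx : x ∈ HP p θ
    · simp [Set.indicator_of_mem hx]
    · simp [Set.indicator_of_notMem hx]
  · have : ∀ᵐ x ∂m, lf p θ x ≠ 0 := by
      rw [ae_iff]; simpa using hm (line_null p θ)
    filter_upwards [this] with x hx
    have hc : Continuous (fun θ => lf p θ x) := by unfold lf; fun_prop
    rcases lt_or_gt_of_ne hx with h | h
    · have : ∀ᶠ θ' in 𝓝 θ, lf p θ' x < 0 := hc.continuousAt.eventually_lt continuousAt_const h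
      refine (continuousAt_const (y := (0:ℝ))).congr ?_
      filter_upwards [this] with θ' h'
      rw [Set.indicator_of_notMem]
      simpa [HP] using h'
    · have : ∀ᶠ θ' in 𝓝 θ, 0 < lf p θ' x := continuousAt_const.eventually_lt hc.continuousAt h
      refine (continuousAt_const (y := (1:ℝ))).congr ?_
      filter_upwards [this] with θ' h'
      rw [Set.indicator_of_mem]
      exact h'.le

theorem HP_split {m : Measure (ℝ × ℝ)} (hm : m ≪ volume) (K : Set (ℝ × ℝ)) (p : ℝ × ℝ) (θ : ℝ) :
    m (K ∩ HP p θ) + m (K ∩ HP p (θ + Real.pi)) = m K := by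
  have h1 : (K ∩ HP p (θ + Real.pi) : Set (ℝ × ℝ)) =ᵐ[m] (K \ HP p θ : Set (ℝ × ℝ)) := by
    have : ∀ᵐ x ∂m, lf p θ x ≠ 0 := by
      rw [ae_iff]; simpa using hm (line_null p θ)
    filter_upwards [this] with x hx
    apply propext
    change (x ∈ K ∧ 0 ≤ lf p (θ + Real.pi) x) ↔ (x ∈ K ∧ ¬ 0 ≤ lf p θ x)
    rw [lf_pi]
    refine and_congr_right fun _ => ⟨fun h h' => hx (by linarith), fun h => by linarith⟩
  rw [measure_congr h1]
  exact measure_inter_add_sdiff _ (HP_closed p θ).measurableSet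

theorem bisect {m m' : Measure (ℝ × ℝ)} [IsFiniteMeasure m] [IsFiniteMeasure m']
    (hm : m ≪ volume) (hm' : m' ≪ volume) (h : m Set.univ = m' Set.univ) (p : ℝ × ℝ) :
    ∃ θ, m (HP p θ) = m' (HP p θ) := by
  have hc : Continuous fun θ => m.real (HP p θ) - m'.real (HP p θ) :=
    (HP_cont hm p).sub (HP_cont hm' p)
  have hanti : ∀ θ, m.real (HP p (θ + Real.pi)) - m'.real (HP p (θ + Real.pi)) =
      - (m.real (HP p θ) - m'.real (HP p θ)) := by
    intro θ
    have h1 := HP_split hm Set.univ p θ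
    have h2 := HP_split hm' Set.univ p θ
    simp only [Set.univ_inter] at h1 h2
    have h1' := congrArg ENNReal.toReal h1
    have h2' := congrArg ENNReal.toReal h2
    rw [ENNReal.toReal_add (measure_ne_top _ _) (measure_ne_top _ _)] at h1' h2'
    rw [h] at h1'
    simp only [Measure.real]
    linarith
  have : (0:ℝ) ∈ Set.range fun θ => m.real (HP p θ) - m'.real (HP p θ) := by
    rcases le_total 0 (m.real (HP p 0) - m'.real (HP p 0)) with h0 | h0
    · refine mem_range_of_exists_le_of_exists_ge hc ⟨0 + Real.pi, ?_⟩ ⟨0, h0⟩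
      rw [hanti]; linarith
    · refine mem_range_of_exists_le_of_exists_ge hc ⟨0, h0⟩ ⟨0 + Real.pi, ?_⟩
      rw [hanti]; linarith
  obtain ⟨θ, hθ⟩ := this
  refine ⟨θ, ?_⟩
  simp only [Measure.real] at hθ
  exact (ENNReal.toReal_eq_toReal_iff' (measure_ne_top _ _) (measure_ne_top _ _)).1 (by linarith)

structure Cell (m₁ m₂ m₃ m₄ : Measure (ℝ × ℝ)) (K : Set (ℝ × ℝ)) : Prop where
  comp : IsCompact K
  conv : Convex ℝ K
  pos : 0 < volume K
  eq : m₁ K = m₃ K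
  le : m₄ K ≤ m₂ K

theorem cell_half_pos {K : Set (ℝ × ℝ)} {p : ℝ × ℝ} (hp : p ∈ interior K) (θ : ℝ) :
    0 < volume (K ∩ HP p θ) := by
  have hcont : Continuous fun s : ℝ => p + s • ((Real.cos θ, Real.sin θ) : ℝ × ℝ) := by fun_prop
  have h1 : ∀ᶠ s in 𝓝 (0:ℝ), p + s • ((Real.cos θ, Real.sin θ) : ℝ × ℝ) ∈ interior K := by
    refine hcont.continuousAt.eventually_mem (isOpen_interior.mem_nhds ?_)
    simpa using hp
  obtain ⟨s, hs, hs0⟩ := ((h1.filter_mono nhdsWithin_le_nhds).and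
    (self_mem_nhdsWithin (a := (0:ℝ)) (s := Set.Ioi 0))).exists
  have hopen : IsOpen (interior K ∩ {x | 0 < lf p θ x}) :=
    isOpen_interior.inter (isOpen_lt continuous_const (lf_cont p θ))
  refine (hopen.measure_pos volume ⟨_, hs, ?_⟩).trans_le (measure_mono ?_)
  · change 0 < lf p θ _
    rw [lf_move]; exact hs0
  · refine Set.inter_subset_inter interior_subset fun x hx => ?_
    change 0 < lf p θ x at hx
    exact le_of_lt hx

theorem half_not_interior (K : Set (ℝ × ℝ)) (p : ℝ × ℝ) (θ : ℝ) :
    p ∉ interior (K ∩ HP p θ) := by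
  intro hp
  have hcont : Continuous fun s : ℝ => p + s • ((Real.cos θ, Real.sin θ) : ℝ × ℝ) := by fun_prop
  have h1 : ∀ᶠ s in 𝓝 (0:ℝ), p + s • ((Real.cos θ, Real.sin θ) : ℝ × ℝ) ∈ interior (K ∩ HP p θ) := by
    refine hcont.continuousAt.eventually_mem (isOpen_interior.mem_nhds ?_)
    simpa using hp
  obtain ⟨s, hs, hs0⟩ := ((h1.filter_mono nhdsWithin_le_nhds).and
    (self_mem_nhdsWithin (a := (0:ℝ)) (s := Set.Iio 0))).exists
  have := (interior_subset hs).2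
  simp only [HP, Set.mem_ofPred_eq, lf_move] at this
  exact absurd hs0 (not_lt.2 this)

theorem cell_step {m₁ m₂ m₃ m₄ : Measure (ℝ × ℝ)} [IsFiniteMeasure m₁] [IsFiniteMeasure m₂]
    [IsFiniteMeasure m₃] [IsFiniteMeasure m₄] (h₁ : m₁ ≪ volume) (h₂ : m₂ ≪ volume)
    (h₃ : m₃ ≪ volume) (h₄ : m₄ ≪ volume) {K : Set (ℝ × ℝ)} (hK : Cell m₁ m₂ m₃ m₄ K)
    (p : ℝ × ℝ) : ∃ K', Cell m₁ m₂ m₃ m₄ K' ∧ K' ⊆ K ∧ p ∉ interior K' := by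
  by_cases hp : p ∈ interior K
  swap
  · exact ⟨K, hK, subset_rfl, hp⟩
  obtain ⟨θ, hθ⟩ := bisect (m := m₁.restrict K) (m' := m₃.restrict K)
    (Measure.restrict_le_self.absolutelyContinuous.trans h₁)
    (Measure.restrict_le_self.absolutelyContinuous.trans h₃) (by simpa using hK.eq) p
  rw [Measure.restrict_apply (HP_closed p θ).measurableSet,
    Measure.restrict_apply (HP_closed p θ).measurableSet, Set.inter_comm] at hθ
  have s1 := HP_split h₁ K p θ
  have s2 := HP_split h₂ K p θ
  have s3 := HP_split h₃ K p θ
  have s4 := HP_split h₄ K p θ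
  have hθ' : m₁ (K ∩ HP p (θ + Real.pi)) = m₃ (K ∩ HP p (θ + Real.pi)) := by
    have := s1.trans (hK.eq.trans s3.symm)
    rw [hθ] at this
    exact (ENNReal.add_right_inj (measure_ne_top _ _)).1 this
  by_cases hle : m₄ (K ∩ HP p θ) ≤ m₂ (K ∩ HP p θ)
  · exact ⟨K ∩ HP p θ, ⟨hK.comp.inter_right (HP_closed _ _), hK.conv.inter (HP_convex _ _),
      cell_half_pos hp θ, hθ, hle⟩, Set.inter_subset_left, half_not_interior _ _ _⟩
  · refine ⟨K ∩ HP p (θ + Real.pi), ⟨hK.comp.inter_right (HP_closed _ _),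
      hK.conv.inter (HP_convex _ _), cell_half_pos hp _, hθ', ?_⟩, Set.inter_subset_left,
      half_not_interior _ _ _⟩
    by_contra hcon
    push Not at hle hcon
    have := ENNReal.add_lt_add hle hcon
    rw [s2, s4] at this
    exact absurd hK.le (not_le.2 this)

theorem cell_seq {m₁ m₂ m₃ m₄ : Measure (ℝ × ℝ)} [IsFiniteMeasure m₁] [IsFiniteMeasure m₂]
    [IsFiniteMeasure m₃] [IsFiniteMeasure m₄] (h₁ : m₁ ≪ volume) (h₂ : m₂ ≪ volume)
    (h₃ : m₃ ≪ volume) (h₄ : m₄ ≪ volume) {Q : Set (ℝ × ℝ)} (hQ : Cell m₁ m₂ m₃ m₄ Q) :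
    ∃ K : ℕ → Set (ℝ × ℝ), Antitone K ∧ (∀ n, Cell m₁ m₂ m₃ m₄ (K n)) ∧ (∀ n, K n ⊆ Q) ∧
      interior (⋂ n, K n) = ∅ := by
  let d : ℕ → ℝ × ℝ := TopologicalSpace.denseSeq (ℝ × ℝ)
  choose! nx hnx1 hnx2 hnx3 using fun (K : Set (ℝ × ℝ)) (p : ℝ × ℝ) (hK : Cell m₁ m₂ m₃ m₄ K) =>
    cell_step h₁ h₂ h₃ h₄ hK p
  let K : ℕ → Set (ℝ × ℝ) := fun n => Nat.rec Q (fun n K => nx K (d n)) n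
  have hcell : ∀ n, Cell m₁ m₂ m₃ m₄ (K n) := by
    intro n
    induction n with
    | zero => exact hQ
    | succ n ih => exact hnx1 _ _ ih
  have hanti : Antitone K := antitone_nat_of_succ_le fun n => hnx2 _ _ (hcell n)
  refine ⟨K, hanti, hcell, fun n => hanti (Nat.zero_le n), ?_⟩
  by_contra hne
  obtain ⟨x, hx⟩ := Set.nonempty_iff_ne_empty.2 hne
  obtain ⟨n, hn⟩ := (TopologicalSpace.denseRange_denseSeq (ℝ × ℝ)).exists_mem_open
    isOpen_interior ⟨x, hx⟩
  exact hnx3 (K n) (d n) (hcell n) (interior_mono (Set.iInter_subset K (n + 1)) hn)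


theorem pair_lim {Q : Set (ℝ × ℝ)} {K : ℕ → Set (ℝ × ℝ)} {φ : ℕ → ℕ} {a b : ℝ × ℝ} {g : ℝ → ℝ}
    (hg : NiceLC g) (hg1 : ∫⁻ t, ENNReal.ofReal (g t) = 1)
    (hlim : ∀ G : ℝ × ℝ → ℝ≥0∞, LowerSemicontinuous G → NI G a b g ≤
      liminf (fun n => (∫⁻ x in K (φ n), G x) / volume (K (φ n))) atTop)
    (hpos : ∀ n, 0 < volume (K n)) (hfin : ∀ n, volume (K n) ≠ ⊤)
    {G₁ G₃ : ℝ × ℝ → ℝ≥0∞} (m₁ : Measurable G₁) (m₃ : Measurable G₃) {M : ℝ≥0∞} (hM : M ≠ ⊤)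
    (hG₁ : ∀ x, G₁ x ≤ M) (l₁ : LowerSemicontinuous fun x => M - G₁ x)
    (l₃ : LowerSemicontinuous G₃) {P Q : ℝ≥0∞} (hP : P ≠ ⊤) (hQ : Q ≠ ⊤)
    (h : ∀ n, P * ∫⁻ x in K n, G₃ x ≤ Q * ∫⁻ x in K n, G₁ x) :
    P * NI G₃ a b g ≤ Q * NI G₁ a b g := by
  have hl : LowerSemicontinuous fun x => Q * (M - G₁ x) + P * G₃ x := by
    refine LowerSemicontinuous.add ?_ ?_
    · exact (ENNReal.continuous_const_mul hQ).comp_lowerSemicontinuous l₁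
        (fun x y hxy => mul_le_mul_right hxy _)
    · exact (ENNReal.continuous_const_mul hP).comp_lowerSemicontinuous l₃
        (fun x y hxy => mul_le_mul_right hxy _)
  have h1 := hlim _ hl
  have h2 : liminf (fun n => (∫⁻ x in K (φ n), (Q * (M - G₁ x) + P * G₃ x)) / volume (K (φ n))) atTop
      ≤ Q * M := by
    refine liminf_le_of_frequently_le' (Frequently.of_forall fun n => ?_)
    rw [ENNReal.div_le_iff (hpos _).ne' (hfin _)]
    rw [lintegral_add_right _ (m₃.const_mul P), lintegral_const_mul _ (by fun_prop),
      lintegral_const_mul _ m₃]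
    calc _ ≤ Q * (∫⁻ x in K (φ n), (M - G₁ x)) + Q * ∫⁻ x in K (φ n), G₁ x :=
          add_le_add_right (h _) _
      _ = Q * ∫⁻ x in K (φ n), M := by
          rw [← mul_add, ← lintegral_add_right _ m₁]
          congr 1
          refine lintegral_congr fun x => tsub_add_cancel_of_le (hG₁ x)
      _ = _ := by rw [setLIntegral_const, mul_assoc]
  have hgm : Measurable fun t => ENNReal.ofReal (g t) := hg.meas.ennreal_ofReal
  have hline : Measurable fun t : ℝ => a + t • b := by fun_prop
  have k1 : Measurable fun t => G₁ (a + t • b) * ENNReal.ofReal (g t) := (m₁.comp hline).mul hgm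
  have k3 : Measurable fun t => G₃ (a + t • b) * ENNReal.ofReal (g t) := (m₃.comp hline).mul hgm
  have k1' : Measurable fun t => (M - G₁ (a + t • b)) * ENNReal.ofReal (g t) :=
    (measurable_const.sub (m₁.comp hline)).mul hgm
  have e1 : NI (fun x => Q * (M - G₁ x) + P * G₃ x) a b g =
      Q * NI (fun x => M - G₁ x) a b g + P * NI G₃ a b g := by
    simp only [NI, add_mul, mul_assoc]
    rw [lintegral_add_right _ (k3.const_mul P), lintegral_const_mul _ k1', lintegral_const_mul _ k3]
  have e2 : NI (fun x => M - G₁ x) a b g + NI G₁ a b g = M := by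
    simp only [NI]
    rw [← lintegral_add_right _ k1]
    simp only [← add_mul, tsub_add_cancel_of_le (hG₁ _)]
    rw [lintegral_const_mul _ hgm, hg1, mul_one]
  have h3 := h1.trans h2
  rw [e1] at h3
  replace h3 := h3.trans_eq (by rw [← mul_add, e2] :
    _ = Q * NI (fun x => M - G₁ x) a b g + Q * NI G₁ a b g)
  have hfin2 : Q * NI (fun x => M - G₁ x) a b g ≠ ⊤ := by
    refine ENNReal.mul_ne_top hQ (ne_top_of_le_ne_top hM ?_)
    exact le_self_add.trans_eq e2
  exact (ENNReal.add_le_add_iff_left hfin2).1 h3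

theorem core {α β : ℝ} (hα : 0 < α) (hβ : 0 < β) {Q : Set (ℝ × ℝ)} (hQc : IsCompact Q)
    (hQ : Convex ℝ Q) (hQp : 0 < volume Q) {G₁ G₂ G₃ G₄ : ℝ × ℝ → ℝ≥0∞}
    (m₁ : Measurable G₁) (m₂ : Measurable G₂) (m₃ : Measurable G₃) (m₄ : Measurable G₄)
    {M η : ℝ≥0∞} (hM : M ≠ ⊤) (hη : η ≠ 0)
    (hG₁ : ∀ x, G₁ x ≤ M) (hG₂ : ∀ x, G₂ x ≤ M) (hG₃ : ∀ x, η ≤ G₃ x) (hG₄ : ∀ x, η ≤ G₄ x)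
    (l₁ : LowerSemicontinuous fun x => M - G₁ x) (l₂ : LowerSemicontinuous fun x => M - G₂ x)
    (l₃ : LowerSemicontinuous G₃) (l₄ : LowerSemicontinuous G₄)
    (i₃ : ∫⁻ x in Q, G₃ x ≠ ⊤) (i₄ : ∫⁻ x in Q, G₄ x ≠ ⊤)
    (hN : NeedleHyp α β G₁ G₂ G₃ G₄) :
    (∫⁻ x in Q, G₁ x) ^ α * (∫⁻ x in Q, G₂ x) ^ β ≤
      (∫⁻ x in Q, G₃ x) ^ α * (∫⁻ x in Q, G₄ x) ^ β := by
  have hQf : volume Q ≠ ⊤ := hQc.measure_ne_top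
  have ib : ∀ G : ℝ × ℝ → ℝ≥0∞, (∀ x, G x ≤ M) → ∫⁻ x in Q, G x ≠ ⊤ := by
    intro G hG
    refine ne_top_of_le_ne_top (b := M * volume Q) (ENNReal.mul_ne_top hM hQf) ?_
    rw [← setLIntegral_const]
    exact lintegral_mono hG
  have i₁ := ib _ hG₁
  have i₂ := ib _ hG₂
  set P₁ := ∫⁻ x in Q, G₁ x with hP₁
  set P₂ := ∫⁻ x in Q, G₂ x with hP₂
  set P₃ := ∫⁻ x in Q, G₃ x with hP₃
  set P₄ := ∫⁻ x in Q, G₄ x with hP₄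
  by_cases z₁ : P₁ = 0
  · simp [z₁, ENNReal.zero_rpow_of_pos hα]
  by_cases z₂ : P₂ = 0
  · simp [z₂, ENNReal.zero_rpow_of_pos hβ]
  let mk : ℝ≥0∞ → (ℝ × ℝ → ℝ≥0∞) → Measure (ℝ × ℝ) := fun c G =>
    (volume.restrict Q).withDensity fun x => c * G x
  have mkf : ∀ c G, Measurable G → c ≠ ⊤ → ∫⁻ x in Q, G x ≠ ⊤ → IsFiniteMeasure (mk c G) := by
    intro c G hG hc hi
    refine isFiniteMeasure_withDensity ?_
    rw [lintegral_const_mul _ hG]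
    exact ENNReal.mul_ne_top hc hi
  have mka : ∀ c G, mk c G ≪ volume := fun c G =>
    (withDensity_absolutelyContinuous _ _).trans Measure.restrict_le_self.absolutelyContinuous
  have mke : ∀ c G, Measurable G → ∀ K, MeasurableSet K → K ⊆ Q →
      mk c G K = c * ∫⁻ x in K, G x := by
    intro c G hG K hK hKQ
    simp only [mk]
    rw [withDensity_apply _ hK, Measure.restrict_restrict hK, Set.inter_eq_left.2 hKQ,
      lintegral_const_mul _ hG]
  have := mkf P₃ G₁ m₁ i₃ i₁
  have := mkf P₄ G₂ m₂ i₄ i₂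
  have := mkf P₁ G₃ m₃ i₁ i₃
  have := mkf P₂ G₄ m₄ i₂ i₄
  have hcell : Cell (mk P₃ G₁) (mk P₄ G₂) (mk P₁ G₃) (mk P₂ G₄) Q := by
    refine ⟨hQc, hQ, hQp, ?_, ?_⟩
    · rw [mke _ _ m₁ _ hQc.measurableSet subset_rfl, mke _ _ m₃ _ hQc.measurableSet subset_rfl,
        mul_comm]
    · rw [mke _ _ m₄ _ hQc.measurableSet subset_rfl, mke _ _ m₂ _ hQc.measurableSet subset_rfl,
        mul_comm]
  obtain ⟨K, hanti, hK, hKQ, hint⟩ := cell_seq (mka _ _) (mka _ _) (mka _ _) (mka _ _) hcell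
  obtain ⟨φ, -, a, b, g, hg, hg1, hlim⟩ := lim_full hanti (fun n => (hK n).comp)
    (fun n => (hK n).conv) (fun n => (hK n).pos) hint
  have r1 : P₁ * NI G₃ a b g ≤ P₃ * NI G₁ a b g := by
    refine pair_lim (Q := Q) hg hg1 hlim (fun n => (hK n).pos) (fun n => (hK n).comp.measure_ne_top)
      m₁ m₃ hM hG₁ l₁ l₃ i₁ i₃ fun n => ?_
    have := (hK n).eq
    rw [mke _ _ m₁ _ (hK n).comp.measurableSet (hKQ n),
      mke _ _ m₃ _ (hK n).comp.measurableSet (hKQ n)] at this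
    exact this.ge
  have r2 : P₂ * NI G₄ a b g ≤ P₄ * NI G₂ a b g := by
    refine pair_lim (Q := Q) hg hg1 hlim (fun n => (hK n).pos) (fun n => (hK n).comp.measure_ne_top)
      m₂ m₄ hM hG₂ l₂ l₄ i₂ i₄ fun n => ?_
    have := (hK n).le
    rwa [mke _ _ m₂ _ (hK n).comp.measurableSet (hKQ n),
      mke _ _ m₄ _ (hK n).comp.measurableSet (hKQ n)] at this
  have hgm : Measurable fun t => ENNReal.ofReal (g t) := hg.meas.ennreal_ofReal
  have up : ∀ G : ℝ × ℝ → ℝ≥0∞, (∀ x, G x ≤ M) → NI G a b g ≠ ⊤ := by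
    intro G hG
    refine ne_top_of_le_ne_top hM ?_
    calc NI G a b g ≤ ∫⁻ t, M * ENNReal.ofReal (g t) :=
          lintegral_mono fun t => mul_le_mul_left (hG _) _
      _ = M := by rw [lintegral_const_mul _ hgm, hg1, mul_one]
  have lo : ∀ G : ℝ × ℝ → ℝ≥0∞, (∀ x, η ≤ G x) → NI G a b g ≠ 0 := by
    intro G hG h0
    have : η ≤ NI G a b g := by
      calc η = ∫⁻ t, η * ENNReal.ofReal (g t) := by
            rw [lintegral_const_mul _ hgm, hg1, mul_one]
        _ ≤ _ := lintegral_mono fun t => mul_le_mul_left (hG _) _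
    rw [h0] at this
    exact hη (le_antisymm this (zero_le))
  have n₃ : NI G₃ a b g ≠ ⊤ := by
    intro h
    rw [h, ENNReal.mul_top z₁] at r1
    exact ENNReal.mul_ne_top i₃ (up _ hG₁) (top_le_iff.1 r1)
  have n₄ : NI G₄ a b g ≠ ⊤ := by
    intro h
    rw [h, ENNReal.mul_top z₂] at r2
    exact ENNReal.mul_ne_top i₄ (up _ hG₂) (top_le_iff.1 r2)
  have key := hN a b g hg n₃ n₄
  have big := mul_le_mul' (ENNReal.rpow_le_rpow r1 hα.le) (ENNReal.rpow_le_rpow r2 hβ.le)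
  simp only [ENNReal.mul_rpow_of_nonneg _ _ hα.le, ENNReal.mul_rpow_of_nonneg _ _ hβ.le] at big
  have c0 : NI G₃ a b g ^ α * NI G₄ a b g ^ β ≠ 0 := by
    refine mul_ne_zero ?_ ?_
    · simp [ENNReal.rpow_eq_zero_iff, lo _ hG₃, not_lt.2 hα.le]
    · simp [ENNReal.rpow_eq_zero_iff, lo _ hG₄, not_lt.2 hβ.le]
  have ct : NI G₃ a b g ^ α * NI G₄ a b g ^ β ≠ ⊤ :=
    ENNReal.mul_ne_top (ENNReal.rpow_ne_top_of_nonneg hα.le n₃)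
      (ENNReal.rpow_ne_top_of_nonneg hβ.le n₄)
  rw [← ENNReal.mul_le_mul_iff_left c0 ct]
  calc _ = P₁ ^ α * NI G₃ a b g ^ α * (P₂ ^ β * NI G₄ a b g ^ β) := by ring
    _ ≤ _ := big
    _ = P₃ ^ α * P₄ ^ β * (NI G₁ a b g ^ α * NI G₂ a b g ^ β) := by ring
    _ ≤ _ := mul_le_mul_right key _

theorem core2 {α β : ℝ} (hα : 0 < α) (hβ : 0 < β) {Q : Set (ℝ × ℝ)} (hQc : IsCompact Q)
    (hQ : Convex ℝ Q) (hQp : 0 < volume Q) {F₁ F₂ F₃ F₄ : ℝ × ℝ → ℝ≥0∞}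
    (m₃ : Measurable F₃) (m₄ : Measurable F₄)
    {M : ℝ≥0∞} (hM : M ≠ ⊤) (hF₁ : ∀ x, F₁ x ≤ M) (hF₂ : ∀ x, F₂ x ≤ M)
    (i₃ : ∫⁻ x in Q, F₃ x ≠ ⊤) (i₄ : ∫⁻ x in Q, F₄ x ≠ ⊤)
    (hN : NeedleHyp α β F₁ F₂ F₃ F₄) :
    (∫⁻ x in Q, F₁ x) ^ α * (∫⁻ x in Q, F₂ x) ^ β ≤
      (∫⁻ x in Q, F₃ x) ^ α * (∫⁻ x in Q, F₄ x) ^ β := by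
  have hQf : volume Q ≠ ⊤ := hQc.measure_ne_top
  have ib : ∀ G : ℝ × ℝ → ℝ≥0∞, (∀ x, G x ≤ M) → ∫⁻ x in Q, G x ≠ ⊤ := by
    intro G hG
    refine ne_top_of_le_ne_top (b := M * volume Q) (ENNReal.mul_ne_top hM hQf) ?_
    rw [← setLIntegral_const]
    exact lintegral_mono hG
  have lowA : ∀ F : ℝ × ℝ → ℝ≥0∞, (∀ x, F x ≤ M) → ∀ δ : ℝ≥0∞, δ ≠ 0 →
      ∃ G : ℝ × ℝ → ℝ≥0∞, Measurable G ∧ (∀ x, G x ≤ F x) ∧ LowerSemicontinuous (fun x => M - G x) ∧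
        ∫⁻ x in Q, F x ≤ (∫⁻ x in Q, G x) + δ := by
    intro F hF δ hδ
    have e : ∀ x, ((F x).toNNReal : ℝ≥0∞) = F x := fun x =>
      ENNReal.coe_toNNReal (ne_top_of_le_ne_top hM (hF x))
    obtain ⟨g, hg, hgu, hgi⟩ := exists_upperSemicontinuous_le_lintegral_le
      (μ := volume.restrict Q) (fun x => (F x).toNNReal) (by simpa only [e] using ib F hF) hδ
    have hus : UpperSemicontinuous fun x => (g x : ℝ≥0∞) :=
      ENNReal.continuous_coe.comp_upperSemicontinuous hgu (fun a b h => ENNReal.coe_le_coe.2 h)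
    refine ⟨fun x => g x, hgu.measurable.coe_nnreal_ennreal, fun x => ?_, ?_, ?_⟩
    · rw [← e]; exact ENNReal.coe_le_coe.2 (hg x)
    · exact (ENNReal.continuous_sub_left hM).comp_upperSemicontinuous_antitone hus
        (fun a b h => tsub_le_tsub_left h M)
    · simpa only [e] using hgi
  have upA : ∀ F : ℝ × ℝ → ℝ≥0∞, Measurable F → ∀ δ : ℝ≥0∞, δ ≠ 0 →
      ∃ G : ℝ × ℝ → ℝ≥0∞, Measurable G ∧ (∀ x, F x ≤ G x) ∧ (∀ x, δ ≤ G x) ∧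
        LowerSemicontinuous G ∧
        ∫⁻ x in Q, G x ≤ (∫⁻ x in Q, F x) + δ * (volume Q + 1) := by
    intro F hF δ hδ
    obtain ⟨G, hG, hGl, hGi⟩ := exists_le_lowerSemicontinuous_lintegral_ge
      (volume.restrict Q) (fun x => F x + δ) (hF.add_const δ) hδ
    refine ⟨G, hGl.measurable, fun x => le_self_add.trans (hG x),
      fun x => le_add_self.trans (hG x), hGl, ?_⟩
    rw [lintegral_add_right _ measurable_const, setLIntegral_const] at hGi
    rwa [mul_add, mul_one, ← add_assoc]
  have step : ∀ δ : ℝ≥0∞, δ ≠ 0 → δ ≠ ⊤ →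
      ((∫⁻ x in Q, F₁ x) - δ) ^ α * ((∫⁻ x in Q, F₂ x) - δ) ^ β ≤
      ((∫⁻ x in Q, F₃ x) + δ * (volume Q + 1)) ^ α *
        ((∫⁻ x in Q, F₄ x) + δ * (volume Q + 1)) ^ β := by
    intro δ hδ hδt
    obtain ⟨G₁, a1, b1, c1, d1⟩ := lowA F₁ hF₁ δ hδ
    obtain ⟨G₂, a2, b2, c2, d2⟩ := lowA F₂ hF₂ δ hδ
    obtain ⟨G₃, a3, b3, e3, c3, d3⟩ := upA F₃ m₃ δ hδ
    obtain ⟨G₄, a4, b4, e4, c4, d4⟩ := upA F₄ m₄ δ hδ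
    have fin : δ * (volume Q + 1) ≠ ⊤ := ENNReal.mul_ne_top hδt (by simp [hQf])
    have hNI : ∀ (F G : ℝ × ℝ → ℝ≥0∞), (∀ x, F x ≤ G x) → ∀ a b g, NI F a b g ≤ NI G a b g :=
      fun F G h a b g => lintegral_mono fun t => mul_le_mul_left (h _) _
    have := core hα hβ hQc hQ hQp a1 a2 a3 a4 hM hδ (fun x => (b1 x).trans (hF₁ x))
      (fun x => (b2 x).trans (hF₂ x)) e3 e4 c1 c2 c3 c4
      (ne_top_of_le_ne_top (ENNReal.add_ne_top.2 ⟨i₃, fin⟩) d3)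
      (ne_top_of_le_ne_top (ENNReal.add_ne_top.2 ⟨i₄, fin⟩) d4) ?_
    · refine le_trans ?_ (this.trans ?_)
      · gcongr
        · exact tsub_le_iff_right.2 d1
        · exact tsub_le_iff_right.2 d2
      · gcongr
    · intro a b g hg n3 n4
      have := hN a b g hg (ne_top_of_le_ne_top n3 (hNI _ _ b3 a b g))
        (ne_top_of_le_ne_top n4 (hNI _ _ b4 a b g))
      refine le_trans ?_ (this.trans ?_)
      · gcongr
        · exact hNI _ _ b1 a b g
        · exact hNI _ _ b2 a b g
      · gcongr
        · exact hNI _ _ b3 a b g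
        · exact hNI _ _ b4 a b g
  let δ : ℕ → ℝ≥0∞ := fun k => ((k:ℝ≥0∞) + 1)⁻¹
  have hδ : Tendsto δ atTop (𝓝 0) := by
    have := (ENNReal.tendsto_inv_nat_nhds_zero).comp (tendsto_add_atTop_nat 1)
    refine this.congr fun k => by simp [δ]
  have t1 : ∀ X : ℝ≥0∞, X ≠ ⊤ → Tendsto (fun k => X - δ k) atTop (𝓝 X) := by
    intro X hX
    simpa using ENNReal.Tendsto.sub (tendsto_const_nhds (x := X)) hδ (Or.inl hX)
  have t2 : ∀ X : ℝ≥0∞, Tendsto (fun k => X + δ k * (volume Q + 1)) atTop (𝓝 X) := by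
    intro X
    have := ENNReal.Tendsto.mul_const hδ (Or.inr (show volume Q + 1 ≠ ⊤ by simp [hQf]))
    simpa using tendsto_const_nhds (x := X).add this
  have tm : ∀ {x y : ℕ → ℝ≥0∞} {X Y : ℝ≥0∞}, X ≠ ⊤ → Y ≠ ⊤ → Tendsto x atTop (𝓝 X) →
      Tendsto y atTop (𝓝 Y) → Tendsto (fun k => x k ^ α * y k ^ β) atTop (𝓝 (X ^ α * Y ^ β)) := by
    intro x y X Y hX hY hx hy
    exact ENNReal.Tendsto.mul ((ENNReal.continuous_rpow_const.tendsto X).comp hx)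
      (Or.inr (ENNReal.rpow_ne_top_of_nonneg hβ.le hY))
      ((ENNReal.continuous_rpow_const.tendsto Y).comp hy)
      (Or.inr (ENNReal.rpow_ne_top_of_nonneg hα.le hX))
  refine le_of_tendsto_of_tendsto' (tm (ib _ hF₁) (ib _ hF₂) (t1 _ (ib _ hF₁)) (t1 _ (ib _ hF₂)))
    (tm i₃ i₄ (t2 _) (t2 _)) fun k => step (δ k) ?_ ?_
  · simp [δ]
  · simp [δ]

theorem TT_plane {α β : ℝ} (hα : 0 < α) (hβ : 0 < β) : TT α β (ℝ × ℝ) := by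
  intro F₁ F₂ F₃ F₄ m₁ m₂ m₃ m₄ i₃ i₄ hN
  let Q : ℕ → Set (ℝ × ℝ) := fun k => Metric.closedBall 0 (k + 1)
  have hQm : ∀ k, MeasurableSet (Q k) := fun k => Metric.isClosed_closedBall.measurableSet
  let T : (ℝ × ℝ → ℝ≥0∞) → ℕ → ℝ × ℝ → ℝ≥0∞ := fun F k x => min (F x) k
  have tl : ∀ F, Measurable F → Tendsto (fun k => ∫⁻ x in Q k, T F k x) atTop (𝓝 (∫⁻ x, F x)) := by
    intro F hF
    simp only [← lintegral_indicator (hQm _)]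
    refine tendsto_trunc volume (fun k => (hF.min measurable_const).indicator (hQm k)) ?_ ?_ ?_
    · intro k l hkl x
      have hkl' : (k:ℝ) + 1 ≤ l + 1 := by
        have : (k:ℝ) ≤ l := by exact_mod_cast hkl
        linarith
      refine (Set.indicator_le_indicator_of_subset (Metric.closedBall_subset_closedBall
        hkl') (fun _ => zero_le) x).trans ?_
      refine Set.indicator_le_indicator ?_
      exact min_le_min le_rfl (by exact_mod_cast hkl)
    · intro x y hy
      obtain ⟨k1, hk1⟩ := exists_nat_ge ‖x‖
      obtain ⟨k2, hk2⟩ := ENNReal.exists_nat_gt (ne_top_of_lt hy)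
      refine ⟨max k1 k2, ?_⟩
      rw [Set.indicator_of_mem]
      · refine le_min hy.le (hk2.le.trans ?_)
        exact_mod_cast le_max_right k1 k2
      · simp only [Q, Metric.mem_closedBall, dist_zero_right]
        have : (k1:ℝ) ≤ (max k1 k2 : ℕ) := by exact_mod_cast le_max_left k1 k2
        linarith
    · intro k x
      exact (Set.indicator_le_self _ _ x).trans (min_le_left _ _)
  refine rpow_lim_le hα hβ (tl F₁ m₁) (tl F₂ m₂) fun k => ?_
  have hNI : ∀ (F G : ℝ × ℝ → ℝ≥0∞), (∀ x, F x ≤ G x) → ∀ a b g, NI F a b g ≤ NI G a b g :=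
    fun F G h a b g => lintegral_mono fun t => mul_le_mul_left (h _) _
  have := core2 (Q := Q k) hα hβ (isCompact_closedBall _ _) (convex_closedBall _ _)
    (Metric.measure_closedBall_pos _ _ (by positivity)) (F₁ := T F₁ k) (F₂ := T F₂ k) m₃ m₄
    (ENNReal.natCast_ne_top k) (fun x => min_le_right _ _) (fun x => min_le_right _ _)
    (ne_top_of_le_ne_top i₃ (setLIntegral_le_lintegral _ _))
    (ne_top_of_le_ne_top i₄ (setLIntegral_le_lintegral _ _)) ?_
  · refine this.trans ?_
    gcongr <;> exact Measure.restrict_le_self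
  · intro a b g hg n3 n4
    refine le_trans ?_ (hN a b g hg n3 n4)
    gcongr
    · exact hNI _ _ (fun x => min_le_left _ _) a b g
    · exact hNI _ _ (fun x => min_le_left _ _) a b g


theorem smooth_approx {c p q d δ : ℝ} {φ : ℝ → ℝ} (hφ : ConvexOn ℝ (Set.Ioo c d) φ)
    (hcp : c < p) (hpq : p < q) (hqd : q < d) (hδ : 0 < δ) :
    ∃ ψ : ℝ → ℝ, ContDiff ℝ (⊤ : ℕ∞) ψ ∧ (∀ t ∈ Set.Ioo p q, |ψ t - φ t| ≤ δ) ∧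
      ∀ t ∈ Set.Ioo p q, 0 ≤ deriv (deriv ψ) t := by
  obtain ⟨c1, hc1, hc1'⟩ := exists_between hcp
  obtain ⟨d1, hd1, hd1'⟩ := exists_between hqd
  have hcont : ContinuousOn φ (Set.Icc c1 d1) :=
    (hφ.continuousOn isOpen_Ioo).mono fun x hx => ⟨hc1.trans_le hx.1, hx.2.trans_lt hd1'⟩
  have huc := isCompact_Icc.uniformContinuousOn_of_continuous hcont
  rw [Metric.uniformContinuousOn_iff] at huc
  obtain ⟨r0, hr0, hr⟩ := huc δ hδ
  let r := min r0 (min (p - c1) (d1 - q))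
  have hrpos : 0 < r := lt_min hr0 (lt_min (by linarith) (by linarith))
  have hr1 : r ≤ p - c1 := (min_le_right _ _).trans (min_le_left _ _)
  have hr2 : r ≤ d1 - q := (min_le_right _ _).trans (min_le_right _ _)
  have hr3 : r ≤ r0 := min_le_left _ _
  let B : ContDiffBump (0:ℝ) := ⟨r / 2, r, by linarith, by linarith⟩
  let φ0 : ℝ → ℝ := (Set.Icc c1 d1).indicator φ
  have hint : Integrable φ0 volume :=
    (integrable_indicator_iff measurableSet_Icc).2 (hcont.integrableOn_Icc)
  have h0 : ∀ x ∈ Set.Icc c1 d1, φ0 x = φ x := fun x hx => Set.indicator_of_mem hx _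
  let ψ : ℝ → ℝ := convolution (B.normed volume) φ0 (ContinuousLinearMap.lsmul ℝ ℝ) volume
  have hsm : ContDiff ℝ (⊤ : ℕ∞) ψ :=
    B.hasCompactSupport_normed.contDiff_convolution_left _ B.contDiff_normed hint.locallyIntegrable
  have hex : ∀ t, Integrable (fun s => B.normed volume s * φ0 (t - s)) volume := by
    intro t
    have := B.hasCompactSupport_normed (μ := volume) |>.convolutionExists_left
      (ContinuousLinearMap.lsmul ℝ ℝ) (B.contDiff_normed (n := 0)).continuous hint.locallyIntegrable t
    simpa [ConvolutionExistsAt] using this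
  have hψ : ∀ t, ψ t = ∫ s, B.normed volume s * φ0 (t - s) := fun t => by
    simp [ψ, convolution]
  have hin : ∀ t ∈ Set.Ioo p q, ∀ x, |x - t| < r → x ∈ Set.Icc c1 d1 := by
    intro t ht x hx
    rw [abs_lt] at hx
    exact ⟨by linarith [ht.1], by linarith [ht.2]⟩
  refine ⟨ψ, hsm, ?_, ?_⟩
  · intro t ht
    have ht' := hin t ht t (by simpa using hrpos)
    have := B.dist_normed_convolution_le (μ := volume) (g := φ0) (x₀ := t) (ε := δ)
      hint.aestronglyMeasurable ?_
    · rw [h0 t ht', Real.dist_eq] at this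
      exact this
    · intro x hx
      have hx' : |x - t| < r := by simpa [Real.dist_eq] using hx
      rw [h0 x (hin t ht x hx'), h0 t ht']
      exact (hr x (hin t ht x hx') t ht' (by rw [Real.dist_eq]; linarith)).le
  · have hcv : ConvexOn ℝ (Set.Ioo p q) ψ := by
      refine ⟨convex_Ioo _ _, fun x hx y hy a b ha hb hab => ?_⟩
      have hxy := convex_Ioo p q hx hy ha hb hab
      simp only [smul_eq_mul] at hxy ⊢
      rw [hψ, hψ, hψ, ← integral_const_mul, ← integral_const_mul,
        ← integral_add ((hex x).const_mul a) ((hex y).const_mul b)]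
      refine integral_mono (hex _) (((hex x).const_mul a).add ((hex y).const_mul b)) fun s => ?_
      by_cases hs : |s| < r
      · have m1 := hin _ hx (x - s) (by simpa using hs)
        have m2 := hin _ hy (y - s) (by simpa using hs)
        have m3 := hin _ hxy (a * x + b * y - s) (by simpa using hs)
        simp only [h0 _ m1, h0 _ m2, h0 _ m3]
        have hsub : Set.Icc c1 d1 ⊆ Set.Ioo c d := fun x hx => ⟨hc1.trans_le hx.1, hx.2.trans_lt hd1'⟩
        have := hφ.2 (hsub m1) (hsub m2) ha hb hab
        have e : a • (x - s) + b • (y - s) = a * x + b * y - s := by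
          have : b = 1 - a := by linarith
          subst this
          simp only [smul_eq_mul]; ring
        rw [e] at this
        simp only [smul_eq_mul] at this
        have hB := B.nonneg_normed (μ := volume) s
        calc _ ≤ _ := mul_le_mul_of_nonneg_left this hB
          _ = _ := by ring
      · have : B.normed volume s = 0 := by
          have : s ∉ Function.support (B.normed volume) := by
            rw [B.support_normed_eq]; simpa [B] using hs
          simpa using this
        simp [this]
    have hdiff : Differentiable ℝ ψ := hsm.differentiable (by simp)
    have hmono := hcv.monotoneOn_deriv fun x _ => hdiff x
    intro t ht
    rw [← derivWithin_of_isOpen isOpen_Ioo ht]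
    exact hmono.derivWithin_nonneg



theorem two_le_smooth : (2 : WithTop ℕ∞) ≤ ((⊤ : ℕ∞) : WithTop ℕ∞) :=
  WithTop.coe_le_coe.2 (le_top (a := (2 : ℕ∞)))

theorem second_deriv {n : ℕ} {κ : ℝ} {Ω : Set (EuclideanSpace ℝ (Fin n))} (ho : IsOpen Ω)
    {ρ : EuclideanSpace ℝ (Fin n) → ℝ} (hρ : ContDiffOn ℝ (⊤ : ℕ∞) ρ Ω)
    (hHess : ∀ x ∈ Ω, ∀ v : EuclideanSpace ℝ (Fin n),
      κ * ‖v‖ ^ 2 ≤ iteratedFDerivWithin ℝ 2 ρ Ω x ![v, v])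
    {a b : EuclideanSpace ℝ (Fin n)} (hb : ‖b‖ = 1) {A : Set ℝ} (hAo : IsOpen A)
    (hA : ∀ t ∈ A, a + t • b ∈ Ω) {ψ : ℝ → ℝ} (hψ : ContDiff ℝ (⊤ : ℕ∞) ψ)
    (hψ2 : ∀ t ∈ A, 0 ≤ deriv (deriv ψ) t) (L : ℝ) :
    ContDiffOn ℝ (⊤ : ℕ∞) (fun t => ρ (a + t • b) + ψ t + L) A ∧
    ∀ t ∈ A, κ ≤ deriv (deriv (fun t => ρ (a + t • b) + ψ t + L)) t := by
  constructor
  · refine ((hρ.comp (f := fun t : ℝ => a + t • b) ?_ hA).add hψ.contDiffOn).add contDiffOn_const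
    exact (contDiff_const.add (contDiff_id.smul contDiff_const)).contDiffOn
  intro t ht
  have hγ : ∀ s : ℝ, HasDerivAt (fun t : ℝ => a + t • b) b s := by
    intro s
    simpa using ((hasDerivAt_id s).smul_const b).const_add a
  have hψd : Differentiable ℝ ψ := hψ.differentiable (by simp)
  have hψdd : Differentiable ℝ (deriv ψ) := by
    have : ContDiff ℝ 2 ψ := hψ.of_le two_le_smooth
    exact (ContDiff.differentiable_deriv_two this)
  have h1 : ∀ s ∈ A, deriv (fun t => ρ (a + t • b) + ψ t + L) s = fderiv ℝ ρ (a + s • b) b + deriv ψ s := by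
    intro s hs
    have hd : DifferentiableAt ℝ ρ (a + s • b) :=
      (hρ.contDiffAt (ho.mem_nhds (hA s hs))).differentiableAt (by simp)
    exact (((hd.hasFDerivAt.comp_hasDerivAt s (hγ s)).add (hψd s).hasDerivAt).add_const L).deriv
  have h2 : deriv (fun t => ρ (a + t • b) + ψ t + L) =ᶠ[𝓝 t]
      fun s => fderiv ℝ ρ (a + s • b) b + deriv ψ s := by
    filter_upwards [hAo.mem_nhds ht] with s hs using h1 s hs
  rw [h2.deriv_eq]
  have hd2 : DifferentiableAt ℝ (fderiv ℝ ρ) (a + t • b) := by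
    have : ContDiffAt ℝ 2 ρ (a + t • b) :=
      (hρ.contDiffAt (ho.mem_nhds (hA t ht))).of_le two_le_smooth
    exact (this.fderiv_right (m := 1) (by norm_num)).differentiableAt (by simp)
  have h3 : HasDerivAt (fun s => fderiv ℝ ρ (a + s • b) b) (fderiv ℝ (fderiv ℝ ρ) (a + t • b) b b) t := by
    have h := hd2.hasFDerivAt.comp_hasDerivAt t (hγ t)
    exact (ContinuousLinearMap.apply ℝ ℝ b).hasFDerivAt.comp_hasDerivAt t h
  have h5 : deriv (fun s => fderiv ℝ ρ (a + s • b) b + deriv ψ s) t =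
      fderiv ℝ (fderiv ℝ ρ) (a + t • b) b b + deriv (deriv ψ) t :=
    (h3.add (hψdd t).hasDerivAt).deriv
  rw [h5]
  have h4 := hHess _ (hA t ht) b
  rw [iteratedFDerivWithin_of_isOpen 2 ho (hA t ht), iteratedFDeriv_two_apply, hb] at h4
  simp at h4
  linarith [hψ2 t ht]

theorem needle_smooth {n : ℕ} {α β κ : ℝ}
    (hα : 0 < α) (hβ : 0 < β)
    {Ω : Set (EuclideanSpace ℝ (Fin n))} (ho : IsOpen Ω)
    {ρ : EuclideanSpace ℝ (Fin n) → ℝ} (hρ : ContDiffOn ℝ (⊤ : ℕ∞) ρ Ω)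
    (hHess : ∀ x ∈ Ω, ∀ v : EuclideanSpace ℝ (Fin n),
      κ * ‖v‖ ^ 2 ≤ iteratedFDerivWithin ℝ 2 ρ Ω x ![v, v])
    {f₁ f₂ f₃ f₄ : EuclideanSpace ℝ (Fin n) → ℝ}
    (hm₁ : Measurable f₁) (hm₂ : Measurable f₂) (hm₃ : Measurable f₃) (hm₄ : Measurable f₄)
    (hp₁ : ∀ x, 0 ≤ f₁ x) (hp₂ : ∀ x, 0 ≤ f₂ x) (hp₃ : ∀ x, 0 ≤ f₃ x) (hp₄ : ∀ x, 0 ≤ f₄ x)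
    (hneedle : ∀ η : Measure (EuclideanSpace ℝ (Fin n)),
      IsCDNeedle κ Ω η → IsProbabilityMeasure η →
      Integrable f₁ η → Integrable f₂ η → Integrable f₃ η → Integrable f₄ η →
      (∫ x, f₁ x ∂η) ^ α * (∫ x, f₂ x ∂η) ^ β ≤
        (∫ x, f₃ x ∂η) ^ α * (∫ x, f₄ x ∂η) ^ β)
    {a b : EuclideanSpace ℝ (Fin n)} (hb : ‖b‖ = 1) {p q : ℝ} (hpq : p < q)
    (hA : ∀ t ∈ Set.Ioo p q, a + t • b ∈ Ω) {ψ : ℝ → ℝ} (hψ : ContDiff ℝ (⊤ : ℕ∞) ψ)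
    (hψ2 : ∀ t ∈ Set.Ioo p q, 0 ≤ deriv (deriv ψ) t)
    {w : ℝ → ℝ≥0∞} (hw : w = fun t => ENNReal.ofReal (Real.exp (-(ρ (a + t • b) + ψ t))))
    (hZ : ∫⁻ t in Set.Ioo p q, w t ≠ ⊤)
    {I : (EuclideanSpace ℝ (Fin n) → ℝ) → ℝ≥0∞}
    (hI : I = fun f => ∫⁻ t in Set.Ioo p q, ENNReal.ofReal (f (a + t • b)) * w t)
    (i₁ : I f₁ ≠ ⊤) (i₂ : I f₂ ≠ ⊤) (i₃ : I f₃ ≠ ⊤) (i₄ : I f₄ ≠ ⊤) :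
    I f₁ ^ α * I f₂ ^ β ≤ I f₃ ^ α * I f₄ ^ β := by
  set A := Set.Ioo p q with hAdef
  have hγm : Measurable fun t : ℝ => a + t • b := by fun_prop
  have hρc : ContinuousOn (fun t : ℝ => ρ (a + t • b)) A :=
    hρ.continuousOn.comp (by fun_prop) hA
  have hwm : AEMeasurable w (volume.restrict A) := by
    rw [hw]
    refine (Real.measurable_exp.comp_aemeasurable ?_).ennreal_ofReal
    exact ((hρc.aemeasurable measurableSet_Ioo).add hψ.continuous.aemeasurable).neg
  set Z := ∫⁻ t in A, w t with hZdef
  by_cases hZ0 : Z = 0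
  · have h0 := (lintegral_eq_zero_iff' hwm).1 hZ0
    have : I f₁ = 0 := by
      rw [hI]
      have : ∀ᵐ t ∂volume.restrict A, ENNReal.ofReal (f₁ (a + t • b)) * w t = 0 := by
        filter_upwards [h0] with t ht
        simp [ht]
      simp only
      rw [lintegral_congr_ae this]; simp
    simp [this, ENNReal.zero_rpow_of_pos hα]
  have hZr : 0 < Z.toReal := ENNReal.toReal_pos hZ0 hZ
  let Ψ : ℝ → ℝ := fun t => ρ (a + t • b) + ψ t + Real.log Z.toReal
  have hΨ : ∀ t, ENNReal.ofReal (Real.exp (-Ψ t)) = Z⁻¹ * w t := by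
    intro t
    simp only [Ψ, hw]
    rw [neg_add, Real.exp_add, Real.exp_neg (Real.log _), Real.exp_log hZr, mul_comm,
      ENNReal.ofReal_mul (by positivity), ENNReal.ofReal_inv_of_pos hZr, ENNReal.ofReal_toReal hZ]
  let ν : Measure ℝ := (volume.restrict A).withDensity fun t => ENNReal.ofReal (Real.exp (-Ψ t))
  let η := Measure.map (fun t : ℝ => a + t • b) ν
  have hΨm : AEMeasurable (fun t => ENNReal.ofReal (Real.exp (-Ψ t))) (volume.restrict A) := by
    simp only [hΨ]; exact hwm.const_mul _
  have hη : ∀ f : EuclideanSpace ℝ (Fin n) → ℝ, Measurable f →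
      ∫⁻ x, ENNReal.ofReal (f x) ∂η = Z⁻¹ * I f := by
    intro f hf
    simp only [η, ν]
    rw [lintegral_map hf.ennreal_ofReal hγm, lintegral_withDensity_eq_lintegral_mul₀ hΨm
      (f := fun t => ENNReal.ofReal (Real.exp (-Ψ t)))
      (g := fun t => ENNReal.ofReal (f (a + t • b)))
      (hf.comp hγm).ennreal_ofReal.aemeasurable, hI]
    simp only [Pi.mul_apply, hΨ]
    rw [← lintegral_const_mul'' (f := fun t => ENNReal.ofReal (f (a + t • b)) * w t) _
      ((hf.comp hγm).ennreal_ofReal.aemeasurable.mul hwm)]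
    refine lintegral_congr fun t => ?_
    ring
  have hprob : IsProbabilityMeasure η := by
    have : η Set.univ = 1 := by
      simp only [η, ν]
      rw [Measure.map_apply hγm MeasurableSet.univ, Set.preimage_univ,
        withDensity_apply _ MeasurableSet.univ, Measure.restrict_univ]
      simp only [hΨ]
      rw [lintegral_const_mul'' _ hwm]
      exact ENNReal.inv_mul_cancel hZ0 hZ
    exact ⟨this⟩
  have hsd := second_deriv ho hρ hHess hb isOpen_Ioo hA hψ hψ2 (Real.log Z.toReal)
  have hneed : IsCDNeedle κ Ω η := by
    refine ⟨A, Ψ, fun t => a + t • b, Set.nonempty_Ioo.2 hpq, isOpen_Ioo, Set.ordConnected_Ioo,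
      hsd.1, hsd.2, hγm, hA, ?_, rfl⟩
    intro s _ t _
    rw [add_sub_add_left_eq_sub, ← sub_smul, norm_smul, hb, mul_one, Real.norm_eq_abs]
  have hint : ∀ f : EuclideanSpace ℝ (Fin n) → ℝ, Measurable f → (∀ x, 0 ≤ f x) → I f ≠ ⊤ →
      Integrable f η := by
    intro f hf hp hi
    refine ⟨hf.aestronglyMeasurable, ?_⟩
    rw [hasFiniteIntegral_iff_ofReal (ae_of_all _ hp), hη f hf]
    exact (ENNReal.mul_ne_top (ENNReal.inv_ne_top.2 hZ0) hi).lt_top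
  have hval : ∀ f : EuclideanSpace ℝ (Fin n) → ℝ, Measurable f → (∀ x, 0 ≤ f x) → 
      ∫ x, f x ∂η = (Z⁻¹ * I f).toReal := by
    intro f hf hp
    rw [integral_eq_lintegral_of_nonneg_ae (ae_of_all _ hp) hf.aestronglyMeasurable, hη f hf]
  have key := hneedle η hneed hprob (hint _ hm₁ hp₁ i₁) (hint _ hm₂ hp₂ i₂) (hint _ hm₃ hp₃ i₃)
    (hint _ hm₄ hp₄ i₄)
  rw [hval _ hm₁ hp₁, hval _ hm₂ hp₂, hval _ hm₃ hp₃, hval _ hm₄ hp₄] at key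
  have hZi : Z⁻¹ ≠ ⊤ := ENNReal.inv_ne_top.2 hZ0
  have hZi0 : Z⁻¹ ≠ 0 := ENNReal.inv_ne_zero.2 hZ
  have tr : ∀ x y : ℝ≥0∞, x ≠ ⊤ → y ≠ ⊤ →
      (Z⁻¹ * x).toReal ^ α * (Z⁻¹ * y).toReal ^ β =
        (Z⁻¹ ^ α * Z⁻¹ ^ β * (x ^ α * y ^ β)).toReal := by
    intro x y hx hy
    rw [ENNReal.toReal_rpow, ENNReal.toReal_rpow, ← ENNReal.toReal_mul,
      ENNReal.mul_rpow_of_nonneg _ _ hα.le, ENNReal.mul_rpow_of_nonneg _ _ hβ.le]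
    congr 1; ring
  rw [tr _ _ i₁ i₂, tr _ _ i₃ i₄] at key
  have nt : ∀ x y : ℝ≥0∞, x ≠ ⊤ → y ≠ ⊤ → x ^ α * y ^ β ≠ ⊤ := fun x y hx hy =>
    ENNReal.mul_ne_top (ENNReal.rpow_ne_top_of_nonneg hα.le hx)
      (ENNReal.rpow_ne_top_of_nonneg hβ.le hy)
  have n0 : Z⁻¹ ^ α * Z⁻¹ ^ β ≠ 0 := by
    refine mul_ne_zero ?_ ?_ <;> simp [ENNReal.rpow_eq_zero_iff, hZ0, hZ]
  rw [ENNReal.toReal_le_toReal (ENNReal.mul_ne_top (nt _ _ hZi hZi) (nt _ _ i₁ i₂))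
    (ENNReal.mul_ne_top (nt _ _ hZi hZi) (nt _ _ i₃ i₄)),
    ENNReal.mul_le_mul_iff_right n0 (nt _ _ hZi hZi)] at key
  exact key


theorem NiceLC.logconvex {g : ℝ → ℝ} (hg : NiceLC g) {S : Set ℝ} (hS : Convex ℝ S)
    (hpos : ∀ t ∈ S, 0 < g t) : ConvexOn ℝ S fun t => -Real.log (g t) := by
  refine ⟨hS, fun x hx y hy a b ha hb hab => ?_⟩
  rcases ha.eq_or_lt with rfl | ha
  · have : b = 1 := by linarith
    subst this; simp
  rcases hb.eq_or_lt with rfl | hb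
  · have : a = 1 := by linarith
    subst this; simp
  have h := hg.lc x y b hb (by linarith)
  have e : 1 - b = a := by linarith
  rw [e] at h
  have h' := Real.log_le_log (mul_pos (Real.rpow_pos_of_pos (hpos x hx) _)
    (Real.rpow_pos_of_pos (hpos y hy) _)) h
  rw [Real.log_mul (Real.rpow_pos_of_pos (hpos x hx) _).ne' (Real.rpow_pos_of_pos (hpos y hy) _).ne',
    Real.log_rpow (hpos x hx), Real.log_rpow (hpos y hy)] at h'
  simp only [smul_eq_mul]
  linarith

theorem NiceLC.scale {g : ℝ → ℝ} (hg : NiceLC g) {l : ℝ} (hl : 0 < l) :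
    NiceLC fun t => g (l⁻¹ * t) := by
  obtain ⟨M, hM⟩ := hg.bdd
  obtain ⟨R, hR⟩ := hg.supp
  refine ⟨hg.meas.comp (measurable_const_mul _), fun x => hg.nonneg _, ⟨M, fun x => hM _⟩,
    ⟨l * R, fun x hx => hR _ ?_⟩, fun x y m hm hm1 => ?_⟩
  · rw [abs_mul, abs_of_pos (inv_pos.2 hl)]
    rwa [lt_inv_mul_iff₀ hl]
  · have := hg.lc (l⁻¹ * x) (l⁻¹ * y) m hm hm1
    convert this using 2
    ring

theorem NI_scale {n : ℕ} {F : EuclideanSpace ℝ (Fin n) → ℝ≥0∞} (hF : Measurable F)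
    {a b : EuclideanSpace ℝ (Fin n)} {g : ℝ → ℝ} (hg : NiceLC g) {l : ℝ} (hl : 0 < l) :
    NI F a (l⁻¹ • b) (fun t => g (l⁻¹ * t)) = ENNReal.ofReal l * NI F a b g := by
  have hline : Measurable fun t : ℝ => a + t • (l⁻¹ • b) := by fun_prop
  have hm : Measurable fun t => F (a + t • (l⁻¹ • b)) * ENNReal.ofReal (g (l⁻¹ * t)) :=
    (hF.comp hline).mul (hg.scale hl).meas.ennreal_ofReal
  simp only [NI]
  conv_lhs => rw [← Real.smul_map_volume_mul_left hl.ne']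
  rw [lintegral_smul_measure, lintegral_map hm (measurable_const_mul l), abs_of_pos hl, smul_eq_mul]
  congr 1
  refine lintegral_congr fun t => ?_
  rw [smul_smul, inv_mul_cancel_left₀ hl.ne', mul_comm l t, mul_assoc, mul_inv_cancel₀ hl.ne', mul_one]

/-- the restricted inequality on a compactly contained interval -/
theorem needle_interval {n : ℕ} {α β κ : ℝ}
    (hα : 0 < α) (hβ : 0 < β)
    {Ω : Set (EuclideanSpace ℝ (Fin n))} (ho : IsOpen Ω)
    {ρ : EuclideanSpace ℝ (Fin n) → ℝ} (hρ : ContDiffOn ℝ (⊤ : ℕ∞) ρ Ω)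
    (hHess : ∀ x ∈ Ω, ∀ v : EuclideanSpace ℝ (Fin n),
      κ * ‖v‖ ^ 2 ≤ iteratedFDerivWithin ℝ 2 ρ Ω x ![v, v])
    {f₁ f₂ f₃ f₄ : EuclideanSpace ℝ (Fin n) → ℝ}
    (hm₁ : Measurable f₁) (hm₂ : Measurable f₂) (hm₃ : Measurable f₃) (hm₄ : Measurable f₄)
    (hp₁ : ∀ x, 0 ≤ f₁ x) (hp₂ : ∀ x, 0 ≤ f₂ x) (hp₃ : ∀ x, 0 ≤ f₃ x) (hp₄ : ∀ x, 0 ≤ f₄ x)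
    (hneedle : ∀ η : Measure (EuclideanSpace ℝ (Fin n)),
      IsCDNeedle κ Ω η → IsProbabilityMeasure η →
      Integrable f₁ η → Integrable f₂ η → Integrable f₃ η → Integrable f₄ η →
      (∫ x, f₁ x ∂η) ^ α * (∫ x, f₂ x ∂η) ^ β ≤
        (∫ x, f₃ x ∂η) ^ α * (∫ x, f₄ x ∂η) ^ β)
    {a b : EuclideanSpace ℝ (Fin n)} (hb : ‖b‖ = 1) {g : ℝ → ℝ} (hg : NiceLC g)
    {c p q d : ℝ} (hcp : c < p) (hqd : q < d)
    (hA : ∀ t ∈ Set.Ioo c d, a + t • b ∈ Ω ∧ 0 < g t)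
    {H : (EuclideanSpace ℝ (Fin n) → ℝ) → ℝ≥0∞}
    (hH : H = fun f => ∫⁻ t in Set.Ioo p q, ENNReal.ofReal (f (a + t • b)) *
      (ENNReal.ofReal (Real.exp (-ρ (a + t • b))) * ENNReal.ofReal (g t)))
    (i₁ : H f₁ ≠ ⊤) (i₂ : H f₂ ≠ ⊤) (i₃ : H f₃ ≠ ⊤) (i₄ : H f₄ ≠ ⊤) :
    H f₁ ^ α * H f₂ ^ β ≤ H f₃ ^ α * H f₄ ^ β := by
  rcases le_or_gt q p with hqp | hpq
  · have : H f₁ = 0 := by simp [hH, Set.Ioo_eq_empty (not_lt.2 hqp)]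
    simp [this, ENNReal.zero_rpow_of_pos hα]
  have hsub : Set.Icc p q ⊆ Set.Ioo c d := fun x hx => ⟨hcp.trans_le hx.1, hx.2.trans_lt hqd⟩
  have hsub' : Set.Ioo p q ⊆ Set.Ioo c d := Set.Ioo_subset_Icc_self.trans hsub
  have hcv := hg.logconvex (convex_Ioo c d) fun t ht => (hA t ht).2
  have step : ∀ δ : ℝ, 0 < δ → H f₁ ^ α * H f₂ ^ β ≤
      (ENNReal.ofReal (Real.exp (2 * δ)) * H f₃) ^ α *
        (ENNReal.ofReal (Real.exp (2 * δ)) * H f₄) ^ β := by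
    intro δ hδ
    obtain ⟨ψ, hψ, hψa, hψ2⟩ := smooth_approx hcv hcp hpq hqd hδ
    let w : ℝ → ℝ≥0∞ := fun t => ENNReal.ofReal (Real.exp (-(ρ (a + t • b) + ψ t)))
    let I : (EuclideanSpace ℝ (Fin n) → ℝ) → ℝ≥0∞ :=
      fun f => ∫⁻ t in Set.Ioo p q, ENNReal.ofReal (f (a + t • b)) * w t
    let e : ℝ≥0∞ := ENNReal.ofReal (Real.exp δ)
    have he : e ≠ ⊤ := ENNReal.ofReal_ne_top
    have b1 : ∀ t ∈ Set.Ioo p q, w t ≤ e *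
        (ENNReal.ofReal (Real.exp (-ρ (a + t • b))) * ENNReal.ofReal (g t)) := by
      intro t ht
      have hgt := (hA t (hsub' ht)).2
      have := abs_le.1 (hψa t ht)
      simp only [w, e]
      rw [← ENNReal.ofReal_mul (Real.exp_pos _).le, ← ENNReal.ofReal_mul (Real.exp_pos _).le]
      refine ENNReal.ofReal_le_ofReal ?_
      rw [← Real.exp_log hgt, ← Real.exp_add, ← Real.exp_add, Real.exp_le_exp]
      linarith
    have b2 : ∀ t ∈ Set.Ioo p q,
        (ENNReal.ofReal (Real.exp (-ρ (a + t • b))) * ENNReal.ofReal (g t)) ≤ e * w t := by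
      intro t ht
      have hgt := (hA t (hsub' ht)).2
      have := abs_le.1 (hψa t ht)
      simp only [w, e]
      rw [← ENNReal.ofReal_mul (Real.exp_pos _).le, ← ENNReal.ofReal_mul (Real.exp_pos _).le]
      refine ENNReal.ofReal_le_ofReal ?_
      rw [← Real.exp_log hgt, ← Real.exp_add, ← Real.exp_add, Real.exp_le_exp]
      linarith
    have B1 : ∀ f, I f ≤ e * H f := by
      intro f
      simp only [I, hH]
      rw [← lintegral_const_mul' _ _ he]
      refine setLIntegral_mono' measurableSet_Ioo fun t ht => ?_
      calc _ ≤ ENNReal.ofReal (f (a + t • b)) * (e *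
            (ENNReal.ofReal (Real.exp (-ρ (a + t • b))) * ENNReal.ofReal (g t))) :=
            mul_le_mul_right (b1 t ht) _
        _ = _ := by ring
    have B2 : ∀ f, H f ≤ e * I f := by
      intro f
      simp only [I, hH]
      rw [← lintegral_const_mul' _ _ he]
      refine setLIntegral_mono' measurableSet_Ioo fun t ht => ?_
      calc _ ≤ ENNReal.ofReal (f (a + t • b)) * (e * w t) := mul_le_mul_right (b2 t ht) _
        _ = _ := by ring
    have hZ : ∫⁻ t in Set.Ioo p q, w t ≠ ⊤ := by
      have hc : ContinuousOn (fun t : ℝ => Real.exp (-(ρ (a + t • b) + ψ t))) (Set.Icc p q) := by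
        refine Real.continuous_exp.comp_continuousOn ?_
        refine ((hρ.continuousOn.comp (f := fun t : ℝ => a + t • b) (by fun_prop)
          fun t ht => (hA t (hsub ht)).1).add hψ.continuous.continuousOn).neg
      have hi := (hc.integrableOn_Icc (μ := volume)).mono_set Set.Ioo_subset_Icc_self
      have := hi.2
      rw [hasFiniteIntegral_iff_ofReal (ae_of_all _ fun t => (Real.exp_pos _).le)] at this
      exact this.ne
    have fin : ∀ f, H f ≠ ⊤ → I f ≠ ⊤ := fun f hf =>
      ne_top_of_le_ne_top (ENNReal.mul_ne_top he hf) (B1 f)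
    have key := needle_smooth hα hβ ho hρ hHess hm₁ hm₂ hm₃ hm₄ hp₁ hp₂ hp₃ hp₄ hneedle hb hpq
      (fun t ht => (hA t (hsub' ht)).1) hψ hψ2 (w := w) rfl hZ (I := I) rfl (fin _ i₁) (fin _ i₂)
      (fin _ i₃) (fin _ i₄)
    have ee : ENNReal.ofReal (Real.exp (2 * δ)) = e * e := by
      simp only [e]
      rw [← ENNReal.ofReal_mul (Real.exp_pos _).le, ← Real.exp_add, two_mul]
    rw [ee]
    calc H f₁ ^ α * H f₂ ^ β ≤ (e * I f₁) ^ α * (e * I f₂) ^ β := by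
          gcongr <;> exact B2 _
      _ = e ^ α * e ^ β * (I f₁ ^ α * I f₂ ^ β) := by
          rw [ENNReal.mul_rpow_of_nonneg _ _ hα.le, ENNReal.mul_rpow_of_nonneg _ _ hβ.le]; ring
      _ ≤ e ^ α * e ^ β * (I f₃ ^ α * I f₄ ^ β) := mul_le_mul_right key _
      _ = (e * I f₃) ^ α * (e * I f₄) ^ β := by
          rw [ENNReal.mul_rpow_of_nonneg _ _ hα.le, ENNReal.mul_rpow_of_nonneg _ _ hβ.le]; ring
      _ ≤ _ := by
          rw [mul_assoc, mul_assoc]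
          gcongr <;> exact B1 _
  let δ : ℕ → ℝ := fun k => 1 / ((k:ℝ) + 1)
  have hδ : Tendsto δ atTop (𝓝 0) := tendsto_one_div_add_atTop_nhds_zero_nat
  have hc : Tendsto (fun k => ENNReal.ofReal (Real.exp (2 * δ k))) atTop (𝓝 1) := by
    have : Continuous fun s => ENNReal.ofReal (Real.exp (2 * s)) :=
      ENNReal.continuous_ofReal.comp (by fun_prop)
    have := (this.tendsto 0).comp hδ
    simpa [Function.comp_def] using this
  have t3 : ∀ X : ℝ≥0∞, X ≠ ⊤ → Tendsto (fun k => ENNReal.ofReal (Real.exp (2 * δ k)) * X) atTop (𝓝 X) := by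
    intro X hX
    simpa using ENNReal.Tendsto.mul_const hc (Or.inr hX)
  refine ge_of_tendsto' (ENNReal.Tendsto.mul
      ((ENNReal.continuous_rpow_const.tendsto _).comp (t3 _ i₃))
      (Or.inr (ENNReal.rpow_ne_top_of_nonneg hβ.le i₄))
      ((ENNReal.continuous_rpow_const.tendsto _).comp (t3 _ i₄))
      (Or.inr (ENNReal.rpow_ne_top_of_nonneg hα.le i₃))) fun k => step (δ k) (by positivity)


noncomputable def wt {n : ℕ} (Ω : Set (EuclideanSpace ℝ (Fin n)))
    (ρ : EuclideanSpace ℝ (Fin n) → ℝ) : EuclideanSpace ℝ (Fin n) → ℝ≥0∞ :=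
  Ω.indicator fun x => ENNReal.ofReal (Real.exp (-ρ x))

theorem wt_meas {n : ℕ} {Ω : Set (EuclideanSpace ℝ (Fin n))} (ho : IsOpen Ω)
    {ρ : EuclideanSpace ℝ (Fin n) → ℝ} (hρ : ContinuousOn ρ Ω) : Measurable (wt Ω ρ) := by
  classical
  unfold wt
  rw [← Set.piecewise_eq_indicator]
  refine ContinuousOn.measurable_piecewise ?_ continuousOn_const ho.measurableSet
  exact ENNReal.continuous_ofReal.comp_continuousOn (Real.continuous_exp.comp_continuousOn hρ.neg)

theorem needle_unit {n : ℕ} {α β κ : ℝ}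
    (hα : 0 < α) (hβ : 0 < β)
    {Ω : Set (EuclideanSpace ℝ (Fin n))} (ho : IsOpen Ω) (hconv : Convex ℝ Ω)
    {ρ : EuclideanSpace ℝ (Fin n) → ℝ} (hρ : ContDiffOn ℝ (⊤ : ℕ∞) ρ Ω)
    (hHess : ∀ x ∈ Ω, ∀ v : EuclideanSpace ℝ (Fin n),
      κ * ‖v‖ ^ 2 ≤ iteratedFDerivWithin ℝ 2 ρ Ω x ![v, v])
    {f₁ f₂ f₃ f₄ : EuclideanSpace ℝ (Fin n) → ℝ}
    (hm₁ : Measurable f₁) (hm₂ : Measurable f₂) (hm₃ : Measurable f₃) (hm₄ : Measurable f₄)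
    (hp₁ : ∀ x, 0 ≤ f₁ x) (hp₂ : ∀ x, 0 ≤ f₂ x) (hp₃ : ∀ x, 0 ≤ f₃ x) (hp₄ : ∀ x, 0 ≤ f₄ x)
    (hneedle : ∀ η : Measure (EuclideanSpace ℝ (Fin n)),
      IsCDNeedle κ Ω η → IsProbabilityMeasure η →
      Integrable f₁ η → Integrable f₂ η → Integrable f₃ η → Integrable f₄ η →
      (∫ x, f₁ x ∂η) ^ α * (∫ x, f₂ x ∂η) ^ β ≤
        (∫ x, f₃ x ∂η) ^ α * (∫ x, f₄ x ∂η) ^ β)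
    {a b : EuclideanSpace ℝ (Fin n)} (hb : ‖b‖ = 1) {g : ℝ → ℝ} (hg : NiceLC g)
    {N : (EuclideanSpace ℝ (Fin n) → ℝ) → ℝ≥0∞}
    (hN : N = fun f => NI (fun x => ENNReal.ofReal (f x) * wt Ω ρ x) a b g)
    (i₁ : N f₁ ≠ ⊤) (i₂ : N f₂ ≠ ⊤) (i₃ : N f₃ ≠ ⊤) (i₄ : N f₄ ≠ ⊤) :
    N f₁ ^ α * N f₂ ^ β ≤ N f₃ ^ α * N f₄ ^ β := by
  let J : Set ℝ := {t | a + t • b ∈ Ω ∧ 0 < g t}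
  let m : (EuclideanSpace ℝ (Fin n) → ℝ) → ℝ → ℝ≥0∞ := fun f t =>
    ENNReal.ofReal (f (a + t • b)) * wt Ω ρ (a + t • b) * ENNReal.ofReal (g t)
  have hNm : ∀ f, N f = ∫⁻ t, m f t := fun f => by rw [hN]; rfl
  have hγm : Measurable fun t : ℝ => a + t • b := by fun_prop
  have hmm : ∀ f, Measurable f → Measurable (m f) := fun f hf =>
    ((hf.comp hγm).ennreal_ofReal.mul ((wt_meas ho hρ.continuousOn).comp hγm)).mul
      hg.meas.ennreal_ofReal
  have hm0 : ∀ f, ∀ t, t ∉ J → m f t = 0 := by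
    intro f t ht
    by_cases h1 : a + t • b ∈ Ω
    · have h2 : ¬ 0 < g t := fun h2 => ht ⟨h1, h2⟩
      simp [m, ENNReal.ofReal_eq_zero.2 (not_lt.1 h2)]
    · simp [m, wt, Set.indicator_of_notMem h1]
  rcases J.eq_empty_or_nonempty with hJ | hJ
  · have : N f₁ = 0 := by
      rw [hNm]
      have : ∀ t, m f₁ t = 0 := fun t => hm0 _ t (by rw [hJ]; simp)
      simp [this]
    simp [this, ENNReal.zero_rpow_of_pos hα]
  have hJc : Convex ℝ J := by
    rintro x ⟨hx1, hx2⟩ y ⟨hy1, hy2⟩ u v hu hv huv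
    constructor
    · have := hconv hx1 hy1 hu hv huv
      have e : a + (u • x + v • y) • b = u • (a + x • b) + v • (a + y • b) := by
        have : v = 1 - u := by linarith
        subst this
        simp only [smul_eq_mul]
        module
      rwa [e]
    · rcases hu.eq_or_lt with rfl | hu
      · have : v = 1 := by linarith
        subst this; simpa using hy2
      rcases hv.eq_or_lt with rfl | hv
      · have : u = 1 := by linarith
        subst this; simpa using hx2
      have h := hg.lc x y v hv (by linarith)
      have e : 1 - v = u := by linarith
      rw [e] at h
      exact (mul_pos (Real.rpow_pos_of_pos hx2 _) (Real.rpow_pos_of_pos hy2 _)).trans_le h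
  obtain ⟨R, hR⟩ := hg.supp
  have hJR : ∀ t ∈ J, |t| ≤ R := by
    intro t ht
    by_contra hcon
    have := hR t (not_le.1 hcon)
    exact absurd ht.2 (by rw [this]; exact lt_irrefl _)
  have hbb : BddBelow J := ⟨-R, fun t ht => (abs_le.1 (hJR t ht)).1⟩
  have hba : BddAbove J := ⟨R, fun t ht => (abs_le.1 (hJR t ht)).2⟩
  have hJ1 : Set.Ioo (sInf J) (sSup J) ⊆ J :=
    IsConnected.Ioo_csInf_csSup_subset ⟨hJ, hJc.isPreconnected⟩ hbb hba
  have hJ2 : J ⊆ Set.Icc (sInf J) (sSup J) := subset_Icc_csInf_csSup hbb hba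
  set c := sInf J
  set d := sSup J
  have hNI : ∀ f, N f = ∫⁻ t in Set.Ioo c d, m f t := by
    intro f
    rw [hNm, setLIntegral_congr Ioo_ae_eq_Icc, setLIntegral_eq_of_support_subset]
    intro t ht
    by_contra hcon
    exact ht (hm0 f t fun h => hcon (hJ2 h))
  let A : ℕ → Set ℝ := fun k => Set.Ioo (c + 1 / ((k:ℝ) + 1)) (d - 1 / ((k:ℝ) + 1))
  have hAs : ∀ k, A k ⊆ Set.Ioo c d := by
    intro k t ht
    have : 0 < 1 / ((k:ℝ) + 1) := by positivity
    exact ⟨by linarith [ht.1], by linarith [ht.2]⟩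
  have tl : ∀ f, Measurable f → Tendsto (fun k => ∫⁻ t in A k, m f t) atTop (𝓝 (N f)) := by
    intro f hf
    rw [hNI]
    have hAm : ∀ k, MeasurableSet (A k) := fun k => measurableSet_Ioo
    simp only [← lintegral_indicator (hAm _), ← lintegral_indicator measurableSet_Ioo]
    refine tendsto_trunc volume (fun k => (hmm f hf).indicator (hAm k)) ?_ ?_ ?_
    · intro k l hkl t
      have h1 : 1 / ((l:ℝ) + 1) ≤ 1 / ((k:ℝ) + 1) := by
        have : (k:ℝ) ≤ l := by exact_mod_cast hkl
        gcongr
      have hs : A k ⊆ A l := fun t ht => Set.mem_Ioo.2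
        ⟨by linarith [(Set.mem_Ioo.1 ht).1], by linarith [(Set.mem_Ioo.1 ht).2]⟩
      exact Set.indicator_le_indicator_of_subset hs (fun _ => zero_le) t
    · intro t y hy
      by_cases ht : t ∈ Set.Ioo c d
      · obtain ⟨k, hk⟩ := exists_nat_one_div_lt (lt_min (sub_pos.2 ht.1) (sub_pos.2 ht.2))
        have h1 := hk.trans_le (min_le_left _ _)
        have h2 := hk.trans_le (min_le_right _ _)
        refine ⟨k, ?_⟩
        rw [Set.indicator_of_mem ht] at hy
        rw [Set.indicator_of_mem (show t ∈ A k from ⟨by linarith, by linarith⟩)]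
        exact hy.le
      · rw [Set.indicator_of_notMem ht] at hy
        exact absurd hy not_lt_zero
    · intro k t
      exact Set.indicator_le_indicator_of_subset (hAs k) (fun _ => zero_le) t
  refine rpow_lim_le hα hβ (tl f₁ hm₁) (tl f₂ hm₂) fun k => ?_
  have hle : ∀ f, ∫⁻ t in A k, m f t ≤ N f := by
    intro f
    rw [hNI]
    exact lintegral_mono_set (hAs k)
  have hpos : 0 < 1 / ((k:ℝ) + 1) := by positivity
  let H : (EuclideanSpace ℝ (Fin n) → ℝ) → ℝ≥0∞ := fun f =>
    ∫⁻ t in A k, ENNReal.ofReal (f (a + t • b)) *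
      (ENNReal.ofReal (Real.exp (-ρ (a + t • b))) * ENNReal.ofReal (g t))
  have hH : ∀ f, H f = ∫⁻ t in A k, m f t := by
    intro f
    refine setLIntegral_congr_fun measurableSet_Ioo fun t ht => ?_
    have := (hJ1 (hAs k ht)).1
    simp only [m, wt]
    rw [Set.indicator_of_mem this, mul_assoc]
  have fin : ∀ f, N f ≠ ⊤ → H f ≠ ⊤ := fun f hf => by
    rw [hH]; exact ne_top_of_le_ne_top hf (hle f)
  have key := needle_interval hα hβ ho hρ hHess hm₁ hm₂ hm₃ hm₄ hp₁ hp₂ hp₃ hp₄ hneedle hb hg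
    (c := c) (d := d) (p := c + 1 / ((k:ℝ) + 1)) (q := d - 1 / ((k:ℝ) + 1))
    (by linarith) (by linarith) (fun t ht => hJ1 ht) (H := H) rfl
    (fin _ i₁) (fin _ i₂) (fin _ i₃) (fin _ i₄)
  rw [hH, hH, hH, hH] at key
  refine key.trans ?_
  gcongr <;> exact hle _


theorem TT_euclid {α β : ℝ} (hα : 0 < α) (hβ : 0 < β) {n : ℕ} (hn : 2 ≤ n) :
    TT α β (EuclideanSpace ℝ (Fin n)) := by
  obtain ⟨m, rfl⟩ : ∃ m, n = m + 1 := ⟨n - 1, by omega⟩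
  exact TT_transfer (WithLp.linearEquiv 2 ℝ (Fin (m+1) → ℝ)).symm.toLinearMap
    (PiLp.volume_preserving_toLp (Fin (m+1))) (TT_pi hα hβ (TT_plane hα hβ) m)

theorem needle_any {n : ℕ} {α β κ : ℝ}
    (hα : 0 < α) (hβ : 0 < β)
    {Ω : Set (EuclideanSpace ℝ (Fin n))} (ho : IsOpen Ω) (hconv : Convex ℝ Ω)
    {ρ : EuclideanSpace ℝ (Fin n) → ℝ} (hρ : ContDiffOn ℝ (⊤ : ℕ∞) ρ Ω)
    (hHess : ∀ x ∈ Ω, ∀ v : EuclideanSpace ℝ (Fin n),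
      κ * ‖v‖ ^ 2 ≤ iteratedFDerivWithin ℝ 2 ρ Ω x ![v, v])
    {f₁ f₂ f₃ f₄ : EuclideanSpace ℝ (Fin n) → ℝ}
    (hm₁ : Measurable f₁) (hm₂ : Measurable f₂) (hm₃ : Measurable f₃) (hm₄ : Measurable f₄)
    (hp₁ : ∀ x, 0 ≤ f₁ x) (hp₂ : ∀ x, 0 ≤ f₂ x) (hp₃ : ∀ x, 0 ≤ f₃ x) (hp₄ : ∀ x, 0 ≤ f₄ x)
    (hneedle : ∀ η : Measure (EuclideanSpace ℝ (Fin n)),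
      IsCDNeedle κ Ω η → IsProbabilityMeasure η →
      Integrable f₁ η → Integrable f₂ η → Integrable f₃ η → Integrable f₄ η →
      (∫ x, f₁ x ∂η) ^ α * (∫ x, f₂ x ∂η) ^ β ≤
        (∫ x, f₃ x ∂η) ^ α * (∫ x, f₄ x ∂η) ^ β)
    {a b : EuclideanSpace ℝ (Fin n)} (hb : b ≠ 0) {g : ℝ → ℝ} (hg : NiceLC g)
    {N : (EuclideanSpace ℝ (Fin n) → ℝ) → ℝ≥0∞}
    (hN : N = fun f => NI (fun x => ENNReal.ofReal (f x) * wt Ω ρ x) a b g)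
    (i₁ : N f₁ ≠ ⊤) (i₂ : N f₂ ≠ ⊤) (i₃ : N f₃ ≠ ⊤) (i₄ : N f₄ ≠ ⊤) :
    N f₁ ^ α * N f₂ ^ β ≤ N f₃ ^ α * N f₄ ^ β := by
  have hl : 0 < ‖b‖ := norm_pos_iff.2 hb
  have hw := wt_meas ho hρ.continuousOn
  have hs : ∀ f, Measurable f → NI (fun x => ENNReal.ofReal (f x) * wt Ω ρ x) a (‖b‖⁻¹ • b)
      (fun t => g (‖b‖⁻¹ * t)) = ENNReal.ofReal ‖b‖ * N f := by
    intro f hf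
    rw [hN]
    exact NI_scale (hf.ennreal_ofReal.mul hw) hg hl
  have hu : ‖‖b‖⁻¹ • b‖ = 1 := by
    rw [norm_smul, norm_inv, norm_norm, inv_mul_cancel₀ hl.ne']
  set c := ENNReal.ofReal ‖b‖ with hc
  have hc0 : c ≠ 0 := by simpa [hc] using hb
  have hct : c ≠ ⊤ := ENNReal.ofReal_ne_top
  have key := needle_unit hα hβ ho hconv hρ hHess hm₁ hm₂ hm₃ hm₄ hp₁ hp₂ hp₃ hp₄ hneedle hu
    (hg.scale hl) (a := a) rfl
    (by simp only [hs _ hm₁]; exact ENNReal.mul_ne_top hct i₁)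
    (by simp only [hs _ hm₂]; exact ENNReal.mul_ne_top hct i₂)
    (by simp only [hs _ hm₃]; exact ENNReal.mul_ne_top hct i₃)
    (by simp only [hs _ hm₄]; exact ENNReal.mul_ne_top hct i₄)
  simp only [hs _ hm₁, hs _ hm₂, hs _ hm₃, hs _ hm₄, ENNReal.mul_rpow_of_nonneg _ _ hα.le,
    ENNReal.mul_rpow_of_nonneg _ _ hβ.le] at key
  rw [mul_mul_mul_comm (c ^ α) (N f₁ ^ α), mul_mul_mul_comm (c ^ α) (N f₃ ^ α)] at key
  have h0 : c ^ α * c ^ β ≠ 0 := mul_ne_zero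
    (ENNReal.rpow_pos (pos_iff_ne_zero.2 hc0) hct).ne'
    (ENNReal.rpow_pos (pos_iff_ne_zero.2 hc0) hct).ne'
  have ht : c ^ α * c ^ β ≠ ⊤ := ENNReal.mul_ne_top (ENNReal.rpow_ne_top_of_nonneg hα.le hct)
    (ENNReal.rpow_ne_top_of_nonneg hβ.le hct)
  exact (ENNReal.mul_le_mul_iff_right h0 ht).1 key

theorem final_aux {n : ℕ} (hn : 2 ≤ n) {α β κ : ℝ}
    (hα : 0 < α) (hβ : 0 < β)
    {Ω : Set (EuclideanSpace ℝ (Fin n))} (ho : IsOpen Ω) (hconv : Convex ℝ Ω)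
    {ρ : EuclideanSpace ℝ (Fin n) → ℝ} (hρ : ContDiffOn ℝ (⊤ : ℕ∞) ρ Ω)
    (hHess : ∀ x ∈ Ω, ∀ v : EuclideanSpace ℝ (Fin n),
      κ * ‖v‖ ^ 2 ≤ iteratedFDerivWithin ℝ 2 ρ Ω x ![v, v])
    {f₁ f₂ f₃ f₄ : EuclideanSpace ℝ (Fin n) → ℝ}
    (hm₁ : Measurable f₁) (hm₂ : Measurable f₂) (hm₃ : Measurable f₃) (hm₄ : Measurable f₄)
    (hp₁ : ∀ x, 0 ≤ f₁ x) (hp₂ : ∀ x, 0 ≤ f₂ x) (hp₃ : ∀ x, 0 ≤ f₃ x) (hp₄ : ∀ x, 0 ≤ f₄ x)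
    (hneedle : ∀ η : Measure (EuclideanSpace ℝ (Fin n)),
      IsCDNeedle κ Ω η → IsProbabilityMeasure η →
      Integrable f₁ η → Integrable f₂ η → Integrable f₃ η → Integrable f₄ η →
      (∫ x, f₁ x ∂η) ^ α * (∫ x, f₂ x ∂η) ^ β ≤
        (∫ x, f₃ x ∂η) ^ α * (∫ x, f₄ x ∂η) ^ β)
    {ε : ℝ≥0∞} (hε : ε ≠ 0) (hεt : ε ≠ ⊤)
    {h : (EuclideanSpace ℝ (Fin n) → ℝ) → EuclideanSpace ℝ (Fin n) → ℝ≥0∞}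
    (hh : h = fun f x => ENNReal.ofReal (f x) * wt Ω ρ x)
    (i₁ : ∫⁻ x, h f₁ x ≠ ⊤) (i₂ : ∫⁻ x, h f₂ x ≠ ⊤) (i₃ : ∫⁻ x, h f₃ x ≠ ⊤)
    (i₄ : ∫⁻ x, h f₄ x ≠ ⊤)
    {G : Set (EuclideanSpace ℝ (Fin n))} (hG : MeasurableSet G)
    (hGp : ∀ x ∈ G, f₁ x ^ α * f₂ x ^ β ≤ f₃ x ^ α * f₄ x ^ β) :
    (∫⁻ x in G, h f₁ x) ^ α * (∫⁻ x, h f₂ x) ^ β ≤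
      ((∫⁻ x, h f₃ x) + ε * ∫⁻ x, (h f₁ x + h f₂ x + h f₃ x + h f₄ x)) ^ α *
      ((∫⁻ x, h f₄ x) + ε * ∫⁻ x, (h f₁ x + h f₂ x + h f₃ x + h f₄ x)) ^ β := by
  have hw := wt_meas ho hρ.continuousOn
  have hhm : ∀ f, Measurable f → Measurable (h f) := fun f hf => by
    rw [hh]; exact hf.ennreal_ofReal.mul hw
  have n₁ := hhm _ hm₁
  have n₂ := hhm _ hm₂
  have n₃ := hhm _ hm₃
  have n₄ := hhm _ hm₄
  let S : EuclideanSpace ℝ (Fin n) → ℝ≥0∞ := fun x => h f₁ x + h f₂ x + h f₃ x + h f₄ x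
  have hS : Measurable S := ((n₁.add n₂).add n₃).add n₄
  have iS : ∫⁻ x, S x ≠ ⊤ := by
    simp only [S]
    rw [lintegral_add_right _ n₄, lintegral_add_right _ n₃, lintegral_add_right _ n₂]
    exact ENNReal.add_ne_top.2 ⟨ENNReal.add_ne_top.2 ⟨ENNReal.add_ne_top.2 ⟨i₁, i₂⟩, i₃⟩, i₄⟩
  have e₃ : (∫⁻ x, h f₃ x) + ε * ∫⁻ x, S x = ∫⁻ x, (h f₃ x + ε * S x) := by
    rw [lintegral_add_left n₃, lintegral_const_mul _ hS]
  have e₄ : (∫⁻ x, h f₄ x) + ε * ∫⁻ x, S x = ∫⁻ x, (h f₄ x + ε * S x) := by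
    rw [lintegral_add_left n₄, lintegral_const_mul _ hS]
  have j₃ : ∫⁻ x, (h f₃ x + ε * S x) ≠ ⊤ := by
    rw [← e₃]; exact ENNReal.add_ne_top.2 ⟨i₃, ENNReal.mul_ne_top hεt iS⟩
  have j₄ : ∫⁻ x, (h f₄ x + ε * S x) ≠ ⊤ := by
    rw [← e₄]; exact ENNReal.add_ne_top.2 ⟨i₄, ENNReal.mul_ne_top hεt iS⟩
  change _ ≤ ((∫⁻ x, h f₃ x) + ε * ∫⁻ x, S x) ^ α * ((∫⁻ x, h f₄ x) + ε * ∫⁻ x, S x) ^ β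
  rw [e₃, e₄, ← lintegral_indicator hG]
  refine TT_euclid hα hβ hn _ _ _ _ (n₁.indicator hG) n₂ (n₃.add (hS.const_mul ε))
    (n₄.add (hS.const_mul ε)) j₃ j₄ ?_
  intro a b g hg k₃ k₄
  have mono : ∀ F F' : EuclideanSpace ℝ (Fin n) → ℝ≥0∞, (∀ x, F x ≤ F' x) →
      NI F a b g ≤ NI F' a b g := fun F F' hF =>
    lintegral_mono fun t => mul_le_mul_left (hF _) _
  have l₃ : NI (h f₃) a b g ≤ NI (fun x => h f₃ x + ε * S x) a b g :=
    mono _ _ fun x => le_self_add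
  have l₄ : NI (h f₄) a b g ≤ NI (fun x => h f₄ x + ε * S x) a b g :=
    mono _ _ fun x => le_self_add
  have l₁ : NI (G.indicator (h f₁)) a b g ≤ NI (h f₁) a b g :=
    mono _ _ fun x => Set.indicator_le_self _ _ _
  by_cases hb : b = 0
  · subst hb
    have hz : ∀ F : EuclideanSpace ℝ (Fin n) → ℝ≥0∞,
        NI F a 0 g = F a * ∫⁻ t, ENNReal.ofReal (g t) := by
      intro F
      simp only [NI, smul_zero, add_zero]
      exact lintegral_const_mul _ hg.meas.ennreal_ofReal
    refine le_trans ?_ (mul_le_mul' (ENNReal.rpow_le_rpow l₃ hα.le)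
      (ENNReal.rpow_le_rpow l₄ hβ.le))
    simp only [hz]
    by_cases hx : a ∈ G
    · rw [Set.indicator_of_mem hx, hh]
      have hr : ENNReal.ofReal (f₁ a) ^ α * ENNReal.ofReal (f₂ a) ^ β ≤
          ENNReal.ofReal (f₃ a) ^ α * ENNReal.ofReal (f₄ a) ^ β := by
        rw [ENNReal.ofReal_rpow_of_nonneg (hp₁ a) hα.le, ENNReal.ofReal_rpow_of_nonneg (hp₂ a) hβ.le,
          ENNReal.ofReal_rpow_of_nonneg (hp₃ a) hα.le, ENNReal.ofReal_rpow_of_nonneg (hp₄ a) hβ.le,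
          ← ENNReal.ofReal_mul (Real.rpow_nonneg (hp₁ a) _),
          ← ENNReal.ofReal_mul (Real.rpow_nonneg (hp₃ a) _)]
        exact ENNReal.ofReal_le_ofReal (hGp a hx)
      simp only [mul_assoc, ENNReal.mul_rpow_of_nonneg _ _ hα.le,
        ENNReal.mul_rpow_of_nonneg _ _ hβ.le]
      generalize wt Ω ρ a ^ α = A at hr ⊢
      generalize wt Ω ρ a ^ β = B at hr ⊢
      generalize (∫⁻ (t : ℝ), ENNReal.ofReal (g t)) ^ α = C at hr ⊢
      generalize (∫⁻ (t : ℝ), ENNReal.ofReal (g t)) ^ β = D at hr ⊢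
      generalize ENNReal.ofReal (f₁ a) ^ α = x₁ at hr ⊢
      generalize ENNReal.ofReal (f₂ a) ^ β = x₂ at hr ⊢
      generalize ENNReal.ofReal (f₃ a) ^ α = x₃ at hr ⊢
      generalize ENNReal.ofReal (f₄ a) ^ β = x₄ at hr ⊢
      calc _ = x₁ * x₂ * (A * B * C * D) := by ring
        _ ≤ x₃ * x₄ * (A * B * C * D) := mul_le_mul_left hr _
        _ = _ := by ring
    · rw [Set.indicator_of_notMem hx]
      simp [ENNReal.zero_rpow_of_pos hα]
  · have fin : ∀ f, (∀ x, h f x ≤ S x) → NI (h f) a b g ≠ ⊤ := by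
      intro f hf hcon
      have h1 : ε * NI (h f) a b g ≤ NI (fun x => h f₃ x + ε * S x) a b g := by
        have : ε * NI (h f) a b g = NI (fun x => ε * h f x) a b g := by
          simp only [NI, mul_assoc]
          rw [lintegral_const_mul' _ _ hεt]
        rw [this]
        exact mono _ _ fun x => (mul_le_mul_right (hf x) ε).trans le_add_self
      rw [hcon, ENNReal.mul_top hε, top_le_iff] at h1
      exact k₃ h1
    have key := needle_any hα hβ ho hconv hρ hHess hm₁ hm₂ hm₃ hm₄ hp₁ hp₂ hp₃ hp₄ hneedle hb hg
      (N := fun f => NI (h f) a b g) (a := a) (by rw [hh])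
      (fin _ fun x => by simp only [S, add_assoc]; exact le_self_add)
      (fin _ fun x => by
        simp only [S]; exact (le_add_self.trans le_self_add).trans le_self_add)
      (fin _ fun x => by simp only [S]; exact le_add_self.trans le_self_add)
      (fin _ fun x => by simp only [S]; exact le_add_self)
    refine le_trans ?_ (key.trans ?_)
    · gcongr
    · gcongr

theorem four_functions_aux {n : ℕ} (hn : 2 ≤ n) (α β κ : ℝ)
    (hα : 0 < α) (hβ : 0 < β)
    (Ω : Set (EuclideanSpace ℝ (Fin n))) (ho : IsOpen Ω)
    (hconv : Convex ℝ Ω)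
    (ρ : EuclideanSpace ℝ (Fin n) → ℝ) (hρ : ContDiffOn ℝ (⊤ : ℕ∞) ρ Ω)
    (hHess : ∀ x ∈ Ω, ∀ v : EuclideanSpace ℝ (Fin n),
      κ * ‖v‖ ^ 2 ≤ iteratedFDerivWithin ℝ 2 ρ Ω x ![v, v])
    (μ : Measure (EuclideanSpace ℝ (Fin n)))
    (hμ : μ = (volume.restrict Ω).withDensity fun x => ENNReal.ofReal (Real.exp (-ρ x)))
    (f₁ f₂ f₃ f₄ : EuclideanSpace ℝ (Fin n) → ℝ)
    (hm₁ : Measurable f₁) (hm₂ : Measurable f₂) (hm₃ : Measurable f₃) (hm₄ : Measurable f₄)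
    (hp₁ : ∀ x, 0 ≤ f₁ x) (hp₂ : ∀ x, 0 ≤ f₂ x) (hp₃ : ∀ x, 0 ≤ f₃ x) (hp₄ : ∀ x, 0 ≤ f₄ x)
    (x₀ : EuclideanSpace ℝ (Fin n))
    (hint : Integrable
      (fun x => (f₁ x + f₂ x + f₃ x + f₄ x) * (1 + ‖x - x₀‖)) μ)
    (hptwise : ∀ᵐ x ∂μ, f₁ x ^ α * f₂ x ^ β ≤ f₃ x ^ α * f₄ x ^ β)
    (hneedle : ∀ η : Measure (EuclideanSpace ℝ (Fin n)),
      IsCDNeedle κ Ω η → IsProbabilityMeasure η →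
      Integrable f₁ η → Integrable f₂ η → Integrable f₃ η → Integrable f₄ η →
      (∫ x, f₁ x ∂η) ^ α * (∫ x, f₂ x ∂η) ^ β ≤
        (∫ x, f₃ x ∂η) ^ α * (∫ x, f₄ x ∂η) ^ β) :
    (∫ x, f₁ x ∂μ) ^ α * (∫ x, f₂ x ∂μ) ^ β ≤
      (∫ x, f₃ x ∂μ) ^ α * (∫ x, f₄ x ∂μ) ^ β := by
  have hw := wt_meas ho hρ.continuousOn
  have hμ' : μ = volume.withDensity (wt Ω ρ) := by
    rw [hμ, wt, withDensity_indicator ho.measurableSet]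
  let h : (EuclideanSpace ℝ (Fin n) → ℝ) → EuclideanSpace ℝ (Fin n) → ℝ≥0∞ :=
    fun f x => ENNReal.ofReal (f x) * wt Ω ρ x
  have hL : ∀ f, Measurable f → ∫⁻ x, h f x = ∫⁻ x, ENNReal.ofReal (f x) ∂μ := by
    intro f hf
    rw [hμ', lintegral_withDensity_eq_lintegral_mul _ hw hf.ennreal_ofReal]
    exact lintegral_congr fun x => mul_comm _ _
  have hint' : ∀ f, Measurable f → (∀ x, 0 ≤ f x) → (∀ x, f x ≤ f₁ x + f₂ x + f₃ x + f₄ x) →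
      Integrable f μ := by
    intro f hf h0 hle
    refine hint.mono' hf.aestronglyMeasurable (ae_of_all _ fun x => ?_)
    rw [Real.norm_of_nonneg (h0 x)]
    have : 0 ≤ f₁ x + f₂ x + f₃ x + f₄ x := (h0 x).trans (hle x)
    nlinarith [hle x, mul_nonneg this (norm_nonneg (x - x₀))]
  have I₁ := hint' f₁ hm₁ hp₁ fun x => by linarith [hp₂ x, hp₃ x, hp₄ x]
  have I₂ := hint' f₂ hm₂ hp₂ fun x => by linarith [hp₁ x, hp₃ x, hp₄ x]
  have I₃ := hint' f₃ hm₃ hp₃ fun x => by linarith [hp₁ x, hp₂ x, hp₄ x]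
  have I₄ := hint' f₄ hm₄ hp₄ fun x => by linarith [hp₁ x, hp₂ x, hp₃ x]
  have fin : ∀ f, Measurable f → Integrable f μ → ∫⁻ x, h f x ≠ ⊤ := by
    intro f hf hi
    rw [hL f hf]
    exact hi.lintegral_lt_top.ne
  let G : Set (EuclideanSpace ℝ (Fin n)) := {x | f₁ x ^ α * f₂ x ^ β ≤ f₃ x ^ α * f₄ x ^ β}
  have hG : MeasurableSet G := measurableSet_le ((hm₁.pow_const α).mul (hm₂.pow_const β))
    ((hm₃.pow_const α).mul (hm₄.pow_const β))
  have hGi : ∫⁻ x in G, h f₁ x = ∫⁻ x, h f₁ x := by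
    rw [hμ', ae_withDensity_iff hw] at hptwise
    rw [← lintegral_indicator hG]
    refine lintegral_congr_ae ?_
    filter_upwards [hptwise] with x hx
    by_cases h0 : wt Ω ρ x = 0
    · by_cases hxG : x ∈ G
      · rw [Set.indicator_of_mem hxG]
      · rw [Set.indicator_of_notMem hxG]
        simp [h, h0]
    · rw [Set.indicator_of_mem (show x ∈ G from hx h0)]
  have n : ∀ f, Measurable f → Measurable (h f) := fun f hf => hf.ennreal_ofReal.mul hw
  have iS : ∫⁻ x, (h f₁ x + h f₂ x + h f₃ x + h f₄ x) ≠ ⊤ := by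
    rw [lintegral_add_right _ (n _ hm₄), lintegral_add_right _ (n _ hm₃),
      lintegral_add_right _ (n _ hm₂)]
    exact ENNReal.add_ne_top.2 ⟨ENNReal.add_ne_top.2 ⟨ENNReal.add_ne_top.2
      ⟨fin _ hm₁ I₁, fin _ hm₂ I₂⟩, fin _ hm₃ I₃⟩, fin _ hm₄ I₄⟩
  have step : ∀ k : ℕ, _ := fun k => final_aux hn hα hβ ho hconv hρ hHess hm₁ hm₂ hm₃ hm₄
    hp₁ hp₂ hp₃ hp₄ hneedle (ε := ((k : ℝ≥0∞) + 1)⁻¹) (by simp) (by simp) (h := h) rfl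
    (fin _ hm₁ I₁) (fin _ hm₂ I₂) (fin _ hm₃ I₃) (fin _ hm₄ I₄) hG (fun x hx => hx)
  rw [hGi] at step
  set T := ∫⁻ x, (h f₁ x + h f₂ x + h f₃ x + h f₄ x)
  have hε : Tendsto (fun k : ℕ => ((k : ℝ≥0∞) + 1)⁻¹) atTop (𝓝 0) := by
    have := (tendsto_add_atTop_iff_nat 1).2 ENNReal.tendsto_inv_nat_nhds_zero
    simpa using this
  have t3 : ∀ X : ℝ≥0∞, Tendsto (fun k : ℕ => X + ((k : ℝ≥0∞) + 1)⁻¹ * T) atTop (𝓝 X) := by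
    intro X
    have := (tendsto_const_nhds (x := X)).add (ENNReal.Tendsto.mul_const hε (Or.inr iS))
    simpa using this
  have fi₃ := fin _ hm₃ I₃
  have fi₄ := fin _ hm₄ I₄
  have main : (∫⁻ x, h f₁ x) ^ α * (∫⁻ x, h f₂ x) ^ β ≤
      (∫⁻ x, h f₃ x) ^ α * (∫⁻ x, h f₄ x) ^ β :=
    ge_of_tendsto' (ENNReal.Tendsto.mul
      ((ENNReal.continuous_rpow_const.tendsto _).comp (t3 _))
      (Or.inr (ENNReal.rpow_ne_top_of_nonneg hβ.le fi₄))
      ((ENNReal.continuous_rpow_const.tendsto _).comp (t3 _))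
      (Or.inr (ENNReal.rpow_ne_top_of_nonneg hα.le fi₃))) step
  have hR : ∀ f, Measurable f → (∀ x, 0 ≤ f x) → ∫ x, f x ∂μ = (∫⁻ x, h f x).toReal := by
    intro f hf h0
    rw [hL f hf, integral_eq_lintegral_of_nonneg_ae (ae_of_all _ h0) hf.aestronglyMeasurable]
  rw [hR _ hm₁ hp₁, hR _ hm₂ hp₂, hR _ hm₃ hp₃, hR _ hm₄ hp₄]
  simp only [ENNReal.toReal_rpow, ← ENNReal.toReal_mul]
  exact ENNReal.toReal_mono (ENNReal.mul_ne_top (ENNReal.rpow_ne_top_of_nonneg hα.le fi₃)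
    (ENNReal.rpow_ne_top_of_nonneg hβ.le fi₄)) main

end

/-- **The four functions theorem (Euclidean case, `N = ∞`)**: if
`f₁^α f₂^β ≤ f₃^α f₄^β` holds `μ`-a.e. and the inequality
`(∫f₁dη)^α(∫f₂dη)^β ≤ (∫f₃dη)^α(∫f₄dη)^β` holds for every `CD(κ,∞)`-needle probability
measure `η` for which the `fᵢ` are integrable, then the same inequality holds for `μ`. -/
theorem four_functions_euclidean {n : ℕ} (hn : 2 ≤ n) (α β κ : ℝ)
    (hα : 0 < α) (hβ : 0 < β)
    (Ω : Set (EuclideanSpace ℝ (Fin n))) (hne : Ω.Nonempty) (ho : IsOpen Ω)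
    (hconv : Convex ℝ Ω)
    (ρ : EuclideanSpace ℝ (Fin n) → ℝ) (hρ : ContDiffOn ℝ (⊤ : ℕ∞) ρ Ω)
    (hHess : ∀ x ∈ Ω, ∀ v : EuclideanSpace ℝ (Fin n),
      κ * ‖v‖ ^ 2 ≤ iteratedFDerivWithin ℝ 2 ρ Ω x ![v, v])
    (μ : Measure (EuclideanSpace ℝ (Fin n)))
    (hμ : μ = (volume.restrict Ω).withDensity fun x => ENNReal.ofReal (Real.exp (-ρ x)))
    (f₁ f₂ f₃ f₄ : EuclideanSpace ℝ (Fin n) → ℝ)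
    (hm₁ : Measurable f₁) (hm₂ : Measurable f₂) (hm₃ : Measurable f₃) (hm₄ : Measurable f₄)
    (hp₁ : ∀ x, 0 ≤ f₁ x) (hp₂ : ∀ x, 0 ≤ f₂ x) (hp₃ : ∀ x, 0 ≤ f₃ x) (hp₄ : ∀ x, 0 ≤ f₄ x)
    (x₀ : EuclideanSpace ℝ (Fin n)) (hx₀ : x₀ ∈ Ω)
    (hint : Integrable
      (fun x => (f₁ x + f₂ x + f₃ x + f₄ x) * (1 + ‖x - x₀‖)) μ)
    (hptwise : ∀ᵐ x ∂μ, f₁ x ^ α * f₂ x ^ β ≤ f₃ x ^ α * f₄ x ^ β)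
    (hneedle : ∀ η : Measure (EuclideanSpace ℝ (Fin n)),
      IsCDNeedle κ Ω η → IsProbabilityMeasure η →
      Integrable f₁ η → Integrable f₂ η → Integrable f₃ η → Integrable f₄ η →
      (∫ x, f₁ x ∂η) ^ α * (∫ x, f₂ x ∂η) ^ β ≤
        (∫ x, f₃ x ∂η) ^ α * (∫ x, f₄ x ∂η) ^ β) :
    (∫ x, f₁ x ∂μ) ^ α * (∫ x, f₂ x ∂μ) ^ β ≤
      (∫ x, f₃ x ∂μ) ^ α * (∫ x, f₄ x ∂μ) ^ β := by
  exact four_functions_aux hn α β κ hα hβ Ω ho hconv ρ hρ hHess μ hμ f₁ f₂ f₃ f₄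
    hm₁ hm₂ hm₃ hm₄ hp₁ hp₂ hp₃ hp₄ x₀ hint hptwise hneedle
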